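/- arXiv:2309.06024 — 2 statements merged into one kernel-verified Lean document; each statement's English description precedes it below -/
import Mathlib

section
/- (Trace embedding of the maximal regularity class, trace-norm form of Proposition 3.1 of Prüss–Simonett 2004.) Let 1<p<∞ and μ∈(1/p,1]. There exists a constant C>0 such that for every u ∈ E_{1,μ} := W^1_{p,μ}(ℝ_+;X_0) ∩ L_{p,μ}(ℝ_+;X_1), the continuous representative of u satisfies u(t) ∈ X_{γ,μ} for every t ≥ 0, the map t ↦ u(t) is bounded and uniformly continuous from [0,∞) into X_{γ,μ} (with its trace norm), and sup_{t≥0} ‖u(t)‖_{X_{γ,μ}} ≤ C ‖u‖_{E_{1,μ}}. -/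
open MeasureTheory Set

noncomputable section

/-- Membership in the weighted space `L_{p,μ}(s;X)`: `f` is (a.e.) strongly measurable on `s`
and `t ↦ t^(1-μ) f t` is `p`-integrable on `s`. -/
def MemWLp {X : Type*} [NormedAddCommGroup X] (p μ : ℝ) (s : Set ℝ) (f : ℝ → X) : Prop :=
  AEStronglyMeasurable f (volume.restrict s) ∧
    IntegrableOn (fun t : ℝ => (t ^ (1 - μ) * ‖f t‖) ^ p) s

/-- The norm of the weighted space `L_{p,μ}(s;X)`. -/
def wLpNorm {X : Type*} [NormedAddCommGroup X] (p μ : ℝ) (s : Set ℝ) (f : ℝ → X) : ℝ :=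
  (∫ t in s, (t ^ (1 - μ) * ‖f t‖) ^ p) ^ (1 / p)

/-- `g` is the weak (distributional) derivative of `u` on the open set `s ⊆ ℝ`;
in particular `u, g ∈ L_{1,loc}(s;X)`. -/
def IsWeakDeriv {X : Type*} [NormedAddCommGroup X] [NormedSpace ℂ X]
    (s : Set ℝ) (u g : ℝ → X) : Prop :=
  LocallyIntegrableOn u s ∧ LocallyIntegrableOn g s ∧
    ∀ φ : ℝ → ℝ, ContDiff ℝ (⊤ : ℕ∞) φ → HasCompactSupport φ → tsupport φ ⊆ s →
      (∫ t in s, deriv φ t • u t) = -∫ t in s, φ t • g t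

/-- `v : s → X` has trace `x` at `t = 0`: it has a representative `w` which is continuous
on `{0} ∪ s` with `w 0 = x`. -/
def HasTrace {X : Type*} [NormedAddCommGroup X] (s : Set ℝ) (v : ℝ → X) (x : X) : Prop :=
  ∃ w : ℝ → X, ContinuousOn w (insert 0 s) ∧
    (∀ᵐ t ∂(volume.restrict s), w t = v t) ∧ w 0 = x

variable {X₀ X₁ : Type*} [NormedAddCommGroup X₀] [NormedSpace ℂ X₀] [CompleteSpace X₀]
  [NormedAddCommGroup X₁] [NormedSpace ℂ X₁] [CompleteSpace X₁]

/-- The graph norm of `A` (with respect to the embedding `ι : X₁ → X₀`) is equivalent to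
the norm of `X₁`. -/
def GraphNormEquiv (ι A : X₁ →L[ℂ] X₀) : Prop :=
  ∃ c₁ > (0 : ℝ), ∃ c₂ > (0 : ℝ), ∀ x : X₁,
    c₁ * ‖x‖ ≤ ‖ι x‖ + ‖A x‖ ∧ ‖ι x‖ + ‖A x‖ ≤ c₂ * ‖x‖

/-- Membership (of the pair `(u, u')`, `u'` being the weak derivative of `u`) in the maximal
regularity class `E_{1,μ}(s) = W^1_{p,μ}(s;X₀) ∩ L_{p,μ}(s;X₁)`, where `ι : X₁ → X₀` is the
embedding. -/
def MemE (p μ : ℝ) (s : Set ℝ) (ι : X₁ →L[ℂ] X₀) (u : ℝ → X₁) (u' : ℝ → X₀) : Prop :=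
  MemWLp p μ s u ∧ MemWLp p μ s (fun t => ι (u t)) ∧ MemWLp p μ s u' ∧
    IsWeakDeriv s (fun t => ι (u t)) u'

/-- The norm of the maximal regularity class `E_{1,μ}(s)`. -/
def eNorm (p μ : ℝ) (s : Set ℝ) (u : ℝ → X₁) (u' : ℝ → X₀) : ℝ :=
  (wLpNorm p μ s u ^ p + wLpNorm p μ s u' ^ p) ^ (1 / p)

/-- `(u, u')` (with `u'` the weak derivative of `u`) solves the linear problem
`u̇ + A u = f` a.e. on `s`, `u(0) = x`, in the class `E_{1,μ}(s)`. -/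
def IsLinSol (p μ : ℝ) (s : Set ℝ) (ι A : X₁ →L[ℂ] X₀) (f : ℝ → X₀) (x : X₀)
    (u : ℝ → X₁) (u' : ℝ → X₀) : Prop :=
  MemE p μ s ι u u' ∧
    (∀ᵐ t ∂(volume.restrict s), u' t + A (u t) = f t) ∧
    HasTrace s (fun t => ι (u t)) x

/-- `A` has maximal `L_{p,μ}`-regularity, `A ∈ MR_{p,μ}(X₀)`: for every
`f ∈ L_{p,μ}(ℝ₊;X₀)` there is a solution `u ∈ W^1_{p,μ}(ℝ₊;X₀) ∩ L_{p,μ}(ℝ₊;X₁)` of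
`u̇ + A u = f`, `u(0) = 0`, and it is unique (up to a.e. equality). -/
def MRw (p μ : ℝ) (ι A : X₁ →L[ℂ] X₀) : Prop :=
  ∀ f : ℝ → X₀, MemWLp p μ (Set.Ioi 0) f →
    (∃ u u', IsLinSol p μ (Set.Ioi 0) ι A f 0 u u') ∧
    ∀ u₁ u₁' u₂ u₂', IsLinSol p μ (Set.Ioi 0) ι A f 0 u₁ u₁' →
      IsLinSol p μ (Set.Ioi 0) ι A f 0 u₂ u₂' →
      ∀ᵐ t ∂(volume.restrict (Set.Ioi 0)), u₁ t = u₂ t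

/-- `x` belongs to the trace space `X_{γ,μ} = {u(0) : u ∈ E_{1,μ}}`. -/
def InTrace (p μ : ℝ) (ι : X₁ →L[ℂ] X₀) (x : X₀) : Prop :=
  ∃ u u', MemE p μ (Set.Ioi 0) ι u u' ∧ HasTrace (Set.Ioi 0) (fun t => ι (u t)) x

/-- The trace norm `‖x‖_{X_{γ,μ}} = inf {‖u‖_{E_{1,μ}} : u ∈ E_{1,μ}, u(0) = x}`. -/
def traceNorm (p μ : ℝ) (ι : X₁ →L[ℂ] X₀) (x : X₀) : ℝ :=
  sInf {r : ℝ | ∃ u u', MemE p μ (Set.Ioi 0) ι u u' ∧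
    HasTrace (Set.Ioi 0) (fun t => ι (u t)) x ∧ r = eNorm p μ (Set.Ioi 0) u u'}

section helpers1
variable {E : Type*} [NormedAddCommGroup E] [NormedSpace ℝ E]

theorem h7_supp_bounds {φ : ℝ → ℝ} (hc : HasCompactSupport φ) (hs : tsupport φ ⊆ Ioi 0) :
    ∃ a > (0:ℝ), ∃ b > a, tsupport φ ⊆ Icc a b := by
  obtain hE | hE := (tsupport φ).eq_empty_or_nonempty
  · exact ⟨1, one_pos, 2, by norm_num, by simp [hE]⟩
  · obtain ⟨a, ha, ha'⟩ := hc.isCompact.exists_isLeast hE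
    obtain ⟨b, hb, hb'⟩ := hc.isCompact.exists_isGreatest hE
    refine ⟨a, hs ha, b + 1, ?_, fun x hx => ⟨ha' hx, ?_⟩⟩
    · have := ha' hb
      show a < b + 1
      linarith
    · have := hb' hx; linarith

theorem h7_zero_of_notMem {φ : ℝ → ℝ} {a b : ℝ} (h : tsupport φ ⊆ Icc a b) {t : ℝ}
    (ht : t ∉ Icc a b) : φ t = 0 := by
  by_contra hne
  exact ht (h (subset_tsupport φ hne))

theorem h7_ibp [CompleteSpace E] (g : ℝ → E) (hg : ∀ R, IntegrableOn g (Ioc 0 R))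
    (φ : ℝ → ℝ) (hφ : ContDiff ℝ (⊤ : ℕ∞) φ) (hc : HasCompactSupport φ)
    (hs : tsupport φ ⊆ Ioi 0) :
    ∫ t in Ioi (0:ℝ), deriv φ t • (∫ s in (0:ℝ)..t, g s) = - ∫ t in Ioi (0:ℝ), φ t • g t := by
  obtain ⟨a, ha, b, hab, hsub⟩ := h7_supp_bounds hc hs
  have hsub' : tsupport (deriv φ) ⊆ Icc a b := (tsupport_deriv_subset).trans hsub
  have hsplit : ∀ F : ℝ → E, (∀ t, t ∉ Icc a b → F t = 0) →
      ∫ t in Ioi (0:ℝ), F t = ∫ t in Ioc (0:ℝ) (b+1), F t := by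
    intro F hF
    refine (setIntegral_eq_of_subset_of_forall_sdiff_eq_zero measurableSet_Ioi
      Ioc_subset_Ioi_self ?_)
    rintro x ⟨hx, hx'⟩
    apply hF
    rintro ⟨h1, h2⟩
    exact hx' ⟨hx, by linarith⟩
  rw [hsplit _ (fun t ht => by rw [h7_zero_of_notMem hsub' ht, zero_smul]),
    hsplit _ (fun t ht => by rw [h7_zero_of_notMem hsub ht, zero_smul])]
  set R := b + 1 with hR
  have hφR : φ R = 0 := h7_zero_of_notMem hsub (by simp [hR])
  have hdc : Continuous (deriv φ) := hφ.continuous_deriv (by simp)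
  set m := (volume : Measure ℝ).restrict (Ioc 0 R) with hm
  have hint : Integrable (fun z : ℝ × ℝ => deriv φ z.1 • g z.2) (m.prod m) := by
    refine Integrable.smul_prod ?_ (hg R)
    exact (hdc.integrableOn_Icc (a := 0) (b := R)).mono_set Ioc_subset_Icc_self
  have hmeas : MeasurableSet {z : ℝ × ℝ | z.2 ≤ z.1} := measurableSet_le measurable_snd measurable_fst
  have hint2 := hint.indicator hmeas
  have e1 : ∫ t in Ioc (0:ℝ) R, deriv φ t • (∫ s in (0:ℝ)..t, g s)
      = ∫ t, ∫ s, ({z : ℝ × ℝ | z.2 ≤ z.1}.indicator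
        (fun z : ℝ × ℝ => deriv φ z.1 • g z.2)) (t, s) ∂m ∂m := by
    refine setIntegral_congr_fun measurableSet_Ioc fun t ht => ?_
    beta_reduce
    rw [intervalIntegral.integral_of_le ht.1.le, ← integral_smul]
    have : (fun s => ({z : ℝ × ℝ | z.2 ≤ z.1}.indicator
        (fun z : ℝ × ℝ => deriv φ z.1 • g z.2)) (t, s))
        = (Iic t).indicator (fun s => deriv φ t • g s) := by
      ext s; simp [indicator]
    rw [this, integral_indicator measurableSet_Iic, hm, Measure.restrict_restrict measurableSet_Iic]
    congr 2
    ext s; simp; constructor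
    · rintro ⟨h1, h2⟩; exact ⟨h2, h1, h2.trans ht.2⟩
    · rintro ⟨h1, h2, h3⟩; exact ⟨h2, h1⟩
  have e2 : ∫ s, ∫ t, ({z : ℝ × ℝ | z.2 ≤ z.1}.indicator
        (fun z : ℝ × ℝ => deriv φ z.1 • g z.2)) (t, s) ∂m ∂m
        = - ∫ t in Ioc (0:ℝ) R, φ t • g t := by
    rw [← integral_neg]
    refine setIntegral_congr_fun measurableSet_Ioc fun s hs => ?_
    beta_reduce
    have : (fun t => ({z : ℝ × ℝ | z.2 ≤ z.1}.indicator
        (fun z : ℝ × ℝ => deriv φ z.1 • g z.2)) (t, s))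
        = (Ici s).indicator (fun t => deriv φ t • g s) := by
      ext t; simp [indicator]
    rw [this, integral_indicator measurableSet_Ici, hm, Measure.restrict_restrict measurableSet_Ici]
    have h2 : Ici s ∩ Ioc 0 R = Icc s R := by
      ext t; constructor
      · rintro ⟨h1, h2, h3⟩; exact ⟨h1, h3⟩
      · rintro ⟨h1, h2⟩; exact ⟨h1, hs.1.trans_le h1, h2⟩
    rw [h2, integral_Icc_eq_integral_Ioc, integral_smul_const, ← intervalIntegral.integral_of_le hs.2,
      intervalIntegral.integral_deriv_eq_sub (fun x _ => (hφ.differentiable (by simp)).differentiableAt)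
        (hdc.intervalIntegrable _ _), hφR]
    simp
  rw [e1, ← e2]
  exact integral_integral_swap (f := fun t s => ({z : ℝ × ℝ | z.2 ≤ z.1}.indicator
        (fun z : ℝ × ℝ => deriv φ z.1 • g z.2)) (t, s)) hint2

/-- du Bois-Reymond. -/
theorem h7_dbr [CompleteSpace E] (v : ℝ → E) (hv : LocallyIntegrableOn v (Ioi 0))
    (h : ∀ φ : ℝ → ℝ, ContDiff ℝ (⊤ : ℕ∞) φ → HasCompactSupport φ → tsupport φ ⊆ Ioi 0 →
      (∫ t in Ioi (0:ℝ), deriv φ t • v t) = 0) :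
    ∃ c : E, ∀ᵐ t ∂(volume.restrict (Ioi (0:ℝ))), v t = c := by
  let B : ContDiffBump (2:ℝ) := ⟨1/2, 1, by norm_num, by norm_num⟩
  set η : ℝ → ℝ := B.normed volume with hη
  have hηd : ContDiff ℝ (⊤ : ℕ∞) η := B.contDiff_normed
  have hηc : HasCompactSupport η := B.hasCompactSupport_normed
  have hηs : tsupport η ⊆ Ioi 0 := by
    rw [hη, B.tsupport_normed_eq, Real.closedBall_eq_Icc]
    intro x hx
    have := hx.1
    simp only [B] at this
    norm_num at this
    exact lt_of_lt_of_le one_pos this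
  have hηi : ∫ t, η t = 1 := B.integral_normed
  have hsm : ∀ ψ : ℝ → ℝ, ContDiff ℝ (⊤ : ℕ∞) ψ → HasCompactSupport ψ → tsupport ψ ⊆ Ioi 0 →
      IntegrableOn (fun t => ψ t • v t) (Ioi 0) := by
    intro ψ h1 h2 h3
    have hK : IntegrableOn (fun t => ψ t • v t) (tsupport ψ) :=
      (hv.integrableOn_compact_subset h3 h2.isCompact).continuousOn_smul
        h1.continuous.continuousOn h2.isCompact
    refine hK.of_forall_sdiff_eq_zero measurableSet_Ioi ?_
    rintro x ⟨_, hx⟩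
    rw [image_eq_zero_of_notMem_tsupport hx, zero_smul]
  refine ⟨∫ t in Ioi (0:ℝ), η t • v t, ?_⟩
  set c := ∫ t in Ioi (0:ℝ), η t • v t with hcdef
  have key := (isOpen_Ioi (a := (0:ℝ))).ae_eq_zero_of_integral_contDiff_smul_eq_zero
    (f := fun t => v t - c) (μ := volume)
    (hv.sub ((locallyIntegrable_const c).locallyIntegrableOn _)) ?_
  · rw [ae_restrict_iff' measurableSet_Ioi]
    filter_upwards [key] with t ht h0
    exact sub_eq_zero.1 (ht h0)
  intro ψ hψ hψc hψs
  rw [← setIntegral_eq_integral_of_forall_compl_eq_zero (s := Ioi 0) (fun x hx => by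
    rw [image_eq_zero_of_notMem_tsupport (fun hh => hx (hψs hh)), zero_smul])]
  obtain ⟨a₁, ha₁, b₁, hab₁, hsub₁⟩ := h7_supp_bounds hψc hψs
  obtain ⟨a₂, ha₂, b₂, hab₂, hsub₂⟩ := h7_supp_bounds hηc hηs
  set a := min a₁ a₂
  set b := max b₁ b₂
  have ha : 0 < a := lt_min ha₁ ha₂
  have hab : a < b := (min_le_left _ _).trans_lt (hab₁.trans_le (le_max_left _ _))
  have hψ0 : ∀ t, t ∉ Icc a b → ψ t = 0 := fun t ht =>
    h7_zero_of_notMem (hsub₁.trans (Icc_subset_Icc (min_le_left _ _) (le_max_left _ _))) ht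
  have hη0 : ∀ t, t ∉ Icc a b → η t = 0 := fun t ht =>
    h7_zero_of_notMem (hsub₂.trans (Icc_subset_Icc (min_le_right _ _) (le_max_right _ _))) ht
  set I := ∫ t, ψ t with hI
  set χ : ℝ → ℝ := fun t => ψ t - I * η t with hχ
  have hχd : ContDiff ℝ (⊤ : ℕ∞) χ := hψ.sub (contDiff_const.mul hηd)
  have hχ0 : ∀ t, t ∉ Icc a b → χ t = 0 := fun t ht => by simp [hχ, hψ0 t ht, hη0 t ht]
  have hχI : ∫ t, χ t = 0 := by
    rw [hχ, integral_sub (hψ.continuous.integrable_of_hasCompactSupport hψc)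
      ((hηd.continuous.integrable_of_hasCompactSupport hηc).const_mul _), integral_const_mul, hηi]
    simp [hI]
  set φ : ℝ → ℝ := fun t => ∫ s in a..t, χ s with hφ
  have hφd : ∀ t, HasDerivAt φ (χ t) t := fun t =>
    intervalIntegral.integral_hasDerivAt_right (hχd.continuous.intervalIntegrable _ _)
      hχd.continuous.stronglyMeasurable.stronglyMeasurableAtFilter hχd.continuous.continuousAt
  have hφderiv : deriv φ = χ := funext fun t => (hφd t).deriv
  have hφC : ContDiff ℝ (⊤ : ℕ∞) φ := by
    refine contDiff_infty_iff_deriv.2 ⟨fun t => (hφd t).differentiableAt, ?_⟩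
    rw [hφderiv]; exact hχd
  have hφ0 : ∀ t, t ∉ Icc a b → φ t = 0 := by
    intro t ht
    by_cases h1 : t < a
    · simp only [hφ]
      rw [intervalIntegral.integral_symm, intervalIntegral.integral_of_le h1.le,
        integral_Ioc_eq_integral_Ioo, setIntegral_eq_zero_of_forall_eq_zero, neg_zero]
      intro x hx
      exact hχ0 x (fun hh => absurd hh.1 (not_le.2 hx.2))
    · have h2 : b < t := by
        by_contra h2
        exact ht ⟨not_lt.1 h1, not_lt.1 h2⟩
      simp only [hφ]
      rw [intervalIntegral.integral_of_le (not_lt.1 h1), ← integral_Icc_eq_integral_Ioc,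
        setIntegral_eq_integral_of_forall_compl_eq_zero, hχI]
      intro x hx
      exact hχ0 x (fun hh => hx ⟨hh.1, hh.2.trans h2.le⟩)
  have hφs : tsupport φ ⊆ Icc a b := by
    refine closure_minimal ?_ isClosed_Icc
    intro x hx
    by_contra hne
    exact hx (hφ0 x hne)
  have h0 := h φ hφC (HasCompactSupport.of_support_subset_isCompact isCompact_Icc
    ((subset_tsupport φ).trans hφs)) (hφs.trans fun x hx => ha.trans_le hx.1)
  rw [hφderiv] at h0
  have hψi : ∫ t in Ioi (0:ℝ), ψ t = I :=
    setIntegral_eq_integral_of_forall_compl_eq_zero (fun x hx => by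
      rw [image_eq_zero_of_notMem_tsupport (fun hh => hx (hψs hh))])
  have i1 := hsm ψ hψ hψc hψs
  have i2 := hsm η hηd hηc hηs
  have e3 : ∫ t in Ioi (0:ℝ), χ t • v t = (∫ t in Ioi (0:ℝ), ψ t • v t) - I • c := by
    rw [hcdef, ← integral_smul, ← integral_sub i1 (g := fun t => I • η t • v t) (i2.smul I)]
    congr 1; ext t; simp [hχ, sub_smul, mul_smul]
  have e4 : ∫ t in Ioi (0:ℝ), ψ t • (v t - c) = (∫ t in Ioi (0:ℝ), ψ t • v t) - I • c := by
    rw [← hψi, ← integral_smul_const, ← integral_sub i1]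
    · congr 1; ext t; simp [smul_sub]
    · exact ((hψ.continuous.integrable_of_hasCompactSupport hψc).integrableOn).smul_const c
  rw [e4, ← e3, h0]

end helpers1

section helpers2

theorem h7_integrableOn {E : Type*} [NormedAddCommGroup E] {p μ : ℝ} (hp : 1 < p) (hμ : 1 / p < μ)
    {g : ℝ → E} (hg : MemWLp p μ (Ioi 0) g) (R : ℝ) : IntegrableOn g (Ioc 0 R) := by
  have hpq := Real.HolderConjugate.conjExponent hp
  set q := p.conjExponent with hq
  have hp0 : 0 < p := by linarith
  have hexp : -1 < (-(1 - μ)) * q := by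
    have hq0 : 0 < q := hpq.symm.pos
    have h1 : p⁻¹ + q⁻¹ = 1 := hpq.inv_add_inv_eq_one
    have h2 : 1 - μ < q⁻¹ := by rw [one_div] at hμ; linarith
    have h3 : (1 - μ) * q < q⁻¹ * q := by gcongr
    rw [inv_mul_cancel₀ hq0.ne'] at h3
    linarith
  have hI1 : IntegrableOn (fun t : ℝ => t ^ ((-(1 - μ)) * q)) (Ioc 0 R) := by
    by_cases hR : 0 ≤ R
    · exact (intervalIntegrable_iff_integrableOn_Ioc_of_le hR).1
        (intervalIntegral.intervalIntegrable_rpow' hexp)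
    · rw [Ioc_eq_empty (by linarith)]; simp
  have hI2 : IntegrableOn (fun t : ℝ => (t ^ (1 - μ) * ‖g t‖) ^ p) (Ioc 0 R) :=
    hg.2.mono_set Ioc_subset_Ioi_self
  refine Integrable.mono' ((hI2.div_const p).add (hI1.div_const q))
    (hg.1.mono_measure (Measure.restrict_mono Ioc_subset_Ioi_self le_rfl)) ?_
  refine (ae_restrict_iff' measurableSet_Ioc).2 (Filter.Eventually.of_forall fun t ht => ?_)
  have hy := Real.young_inequality_of_nonneg (a := t ^ (1 - μ) * ‖g t‖) (b := t ^ (-(1 - μ)))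
    (mul_nonneg (Real.rpow_nonneg ht.1.le _) (norm_nonneg _)) (Real.rpow_nonneg ht.1.le _) hpq
  have e : t ^ (1 - μ) * ‖g t‖ * t ^ (-(1 - μ)) = ‖g t‖ := by
    rw [Real.rpow_neg ht.1.le]
    have := (Real.rpow_pos_of_pos ht.1 (1 - μ)).ne'
    field_simp
  rw [e, ← Real.rpow_mul ht.1.le] at hy
  exact hy

theorem h7_rep {E : Type*} [NormedAddCommGroup E] [NormedSpace ℂ E] [CompleteSpace E]
    {p μ : ℝ} (hp : 1 < p) (hμ : 1 / p < μ)
    {f g : ℝ → E} (hg : MemWLp p μ (Ioi 0) g) (h : IsWeakDeriv (Ioi 0) f g) :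
    ∃ w : ℝ → E, ContinuousOn w (Ici 0) ∧ ∀ᵐ t ∂(volume.restrict (Ioi (0:ℝ))), w t = f t := by
  have hgi := h7_integrableOn hp hμ hg
  set W : ℝ → E := fun t => ∫ s in (0:ℝ)..t, g s with hW
  have hWc : ContinuousOn W (Ici 0) := by
    have hloc : LocallyIntegrable ((Ioi (0:ℝ)).indicator g) := by
      rw [locallyIntegrable_iff]
      intro K hK
      obtain ⟨R, hR⟩ := hK.bddAbove
      rw [integrableOn_indicator_iff measurableSet_Ioi]
      refine (hgi R).mono_set ?_
      rintro x ⟨h1, h2⟩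
      exact ⟨h1, hR h2⟩
    have hc : Continuous (fun t => ∫ s in (0:ℝ)..t, (Ioi (0:ℝ)).indicator g s) :=
      intervalIntegral.continuous_primitive (fun a b => (locallyIntegrable_iff.1 hloc _ isCompact_uIcc).intervalIntegrable) 0
    refine hc.continuousOn.congr fun t ht => ?_
    simp only [hW]
    rw [intervalIntegral.integral_of_le ht, intervalIntegral.integral_of_le ht]
    refine setIntegral_congr_fun measurableSet_Ioc fun s hs => ?_
    simp [indicator, hs.1]
  have hWl : LocallyIntegrableOn W (Ioi 0) :=
    (hWc.mono Ioi_subset_Ici_self).locallyIntegrableOn measurableSet_Ioi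
  have hint : ∀ {F : ℝ → E}, LocallyIntegrableOn F (Ioi 0) → 
      ∀ ψ : ℝ → ℝ, Continuous ψ → HasCompactSupport ψ → tsupport ψ ⊆ Ioi 0 →
      IntegrableOn (fun t => ψ t • F t) (Ioi 0) := by
    intro F hF ψ h1 h2 h3
    have hK : IntegrableOn (fun t => ψ t • F t) (tsupport ψ) :=
      (hF.integrableOn_compact_subset h3 h2.isCompact).continuousOn_smul
        h1.continuousOn h2.isCompact
    refine hK.of_forall_sdiff_eq_zero measurableSet_Ioi ?_
    rintro x ⟨_, hx⟩
    rw [image_eq_zero_of_notMem_tsupport hx, zero_smul]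
  obtain ⟨c, hc⟩ := h7_dbr (fun t => f t - W t) (h.1.sub hWl) (by
    intro φ h1 h2 h3
    have hd : Continuous (deriv φ) := h1.continuous_deriv (by simp)
    have j1 := hint h.1 (deriv φ) hd h2.deriv (tsupport_deriv_subset.trans h3)
    have j2 := hint hWl (deriv φ) hd h2.deriv (tsupport_deriv_subset.trans h3)
    simp only [smul_sub]
    rw [integral_sub j1 j2, h.2.2 φ h1 h2 h3, hW, h7_ibp g hgi φ h1 h2 h3, sub_self])
  refine ⟨fun t => W t + c, hWc.add continuousOn_const, ?_⟩
  filter_upwards [hc] with t ht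
  rw [← ht]; abel

end helpers2

section helpers3
open scoped ENNReal

/-- The weight as an extended nonnegative function. -/
def h7rho (p μ : ℝ) (t : ℝ) : ℝ≥0∞ := ENNReal.ofReal (t ^ ((1 - μ) * p))

/-- The `p`-th power of the weighted norm. -/
def h7N {E : Type*} [NormedAddCommGroup E] (p μ : ℝ) (f : ℝ → E) : ℝ≥0∞ :=
  ∫⁻ t in Ioi (0:ℝ), h7rho p μ t * ‖f t‖ₑ ^ p

/-- The weighted measure. -/
def h7nu (p μ : ℝ) : Measure ℝ := (volume.restrict (Ioi (0:ℝ))).withDensity (h7rho p μ)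

variable {E : Type*} [NormedAddCommGroup E] {p μ : ℝ}

theorem h7_exp_nonneg (hp : 1 < p) (hμ1 : μ ≤ 1) : 0 ≤ (1 - μ) * p :=
  mul_nonneg (by linarith) (by linarith)

theorem h7_rho_meas : Measurable (h7rho p μ) := by
  unfold h7rho; fun_prop

theorem h7_pt (hp : 1 < p) (f : ℝ → E) {t : ℝ} (ht : 0 < t) :
    ENNReal.ofReal ((t ^ (1 - μ) * ‖f t‖) ^ p) = h7rho p μ t * ‖f t‖ₑ ^ p := by
  have h1 : 0 ≤ t ^ (1 - μ) := Real.rpow_nonneg ht.le _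
  rw [Real.mul_rpow h1 (norm_nonneg _), ← Real.rpow_mul ht.le,
    ENNReal.ofReal_mul (Real.rpow_nonneg ht.le _),
    ← ENNReal.ofReal_rpow_of_nonneg (norm_nonneg _) (by linarith), ofReal_norm_eq_enorm, h7rho]

theorem h7_lint (hp : 1 < p) (f : ℝ → E) :
    ∫⁻ t in Ioi (0:ℝ), ENNReal.ofReal ((t ^ (1 - μ) * ‖f t‖) ^ p) = h7N p μ f :=
  setLIntegral_congr_fun measurableSet_Ioi fun _ ht => h7_pt hp f ht

theorem h7_nonneg (f : ℝ → E) :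
    0 ≤ᵐ[volume.restrict (Ioi (0:ℝ))] fun t : ℝ => (t ^ (1 - μ) * ‖f t‖) ^ p := by
  refine (ae_restrict_iff' measurableSet_Ioi).2 (Filter.Eventually.of_forall fun t ht => ?_)
  exact Real.rpow_nonneg (mul_nonneg (Real.rpow_nonneg (le_of_lt ht) _) (norm_nonneg _)) _

theorem h7_aesm {f : ℝ → E} (hf : AEStronglyMeasurable f (volume.restrict (Ioi (0:ℝ)))) :
    AEStronglyMeasurable (fun t : ℝ => (t ^ (1 - μ) * ‖f t‖) ^ p) (volume.restrict (Ioi (0:ℝ))) := by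
  refine AEMeasurable.aestronglyMeasurable ?_
  have h1 : AEMeasurable (fun t : ℝ => t ^ (1 - μ)) (volume.restrict (Ioi (0:ℝ))) := by fun_prop
  exact (h1.mul hf.norm.aemeasurable).pow_const p

theorem h7_mem_iff (hp : 1 < p) (f : ℝ → E) :
    MemWLp p μ (Ioi 0) f ↔
      AEStronglyMeasurable f (volume.restrict (Ioi (0:ℝ))) ∧ h7N p μ f < ∞ := by
  unfold MemWLp
  refine and_congr_right fun hf => ?_
  rw [IntegrableOn, Integrable, hasFiniteIntegral_iff_ofReal (h7_nonneg f), h7_lint hp f]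
  exact ⟨fun h => h.2, fun h => ⟨h7_aesm hf, h⟩⟩

theorem h7_norm_eq (hp : 1 < p) {f : ℝ → E} (hf : MemWLp p μ (Ioi 0) f) :
    wLpNorm p μ (Ioi 0) f ^ p = (h7N p μ f).toReal := by
  unfold wLpNorm
  rw [integral_eq_lintegral_of_nonneg_ae (h7_nonneg f) (h7_aesm hf.1), h7_lint hp f,
    ← Real.rpow_mul ENNReal.toReal_nonneg, one_div_mul_cancel (by linarith), Real.rpow_one]

theorem h7_N_eq (hp : 1 < p) (f : ℝ → E) :
    h7N p μ f = eLpNorm f (ENNReal.ofReal p) (h7nu p μ) ^ p := by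
  have hp0 : 0 < p := by linarith
  rw [eLpNorm_eq_lintegral_rpow_enorm_toReal (by simpa using hp0) ENNReal.ofReal_ne_top,
    ENNReal.toReal_ofReal hp0.le, ← ENNReal.rpow_mul, one_div_mul_cancel hp0.ne', ENNReal.rpow_one,
    h7nu, lintegral_withDensity_eq_lintegral_mul_non_measurable _ h7_rho_meas]
  · rfl
  · exact Filter.Eventually.of_forall fun t => ENNReal.ofReal_lt_top

theorem h7_memLp (hp : 1 < p) {f : ℝ → E} (hf : MemWLp p μ (Ioi 0) f) :
    MemLp f (ENNReal.ofReal p) (h7nu p μ) := by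
  have h := (h7_mem_iff hp f).1 hf
  refine ⟨h.1.mono_ac (withDensity_absolutelyContinuous _ _), ?_⟩
  rw [h7_N_eq hp] at h
  exact (ENNReal.rpow_lt_top_iff_of_pos (by linarith)).1 h.2

theorem h7_mem_sub (hp : 1 < p) {f g : ℝ → E} (hf : MemWLp p μ (Ioi 0) f)
    (hg : MemWLp p μ (Ioi 0) g) : MemWLp p μ (Ioi 0) (fun t => f t - g t) := by
  refine (h7_mem_iff hp _).2 ⟨hf.1.sub hg.1, ?_⟩
  rw [h7_N_eq hp]
  exact (ENNReal.rpow_lt_top_iff_of_pos (by linarith)).2 ((h7_memLp hp hf).sub (h7_memLp hp hg)).2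

theorem h7_qmp {h : ℝ} (hh : 0 ≤ h) : Measure.QuasiMeasurePreserving (fun t : ℝ => t + h)
    (volume.restrict (Ioi (0:ℝ))) (volume.restrict (Ioi (0:ℝ))) := by
  refine ((measurePreserving_add_right volume h).quasiMeasurePreserving).restrict ?_
  intro t ht
  exact add_pos_of_pos_of_nonneg ht hh

theorem h7_N_shift (hp : 1 < p) (hμ1 : μ ≤ 1) (f : ℝ → E) {h : ℝ} (hh : 0 ≤ h) :
    h7N p μ (fun t => f (t + h)) ≤ h7N p μ f := by
  unfold h7N
  rw [← lintegral_indicator measurableSet_Ioi, ← lintegral_indicator measurableSet_Ioi,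
    ← lintegral_add_right_eq_self ((Ioi (0:ℝ)).indicator fun t => h7rho p μ t * ‖f t‖ₑ ^ p) h]
  refine lintegral_mono fun t => ?_
  by_cases ht : t ∈ Ioi (0:ℝ)
  · have ht0 : (0:ℝ) < t := ht
    have ht' : t + h ∈ Ioi (0:ℝ) := add_pos_of_pos_of_nonneg ht0 hh
    rw [indicator_of_mem ht, indicator_of_mem ht']
    gcongr
    unfold h7rho
    exact ENNReal.ofReal_le_ofReal
      (Real.rpow_le_rpow ht0.le (by linarith) (h7_exp_nonneg hp hμ1))
  · rw [indicator_of_notMem ht]; exact zero_le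

theorem h7_mem_shift (hp : 1 < p) (hμ1 : μ ≤ 1) {f : ℝ → E} (hf : MemWLp p μ (Ioi 0) f)
    {h : ℝ} (hh : 0 ≤ h) : MemWLp p μ (Ioi 0) (fun t => f (t + h)) := by
  have h' := (h7_mem_iff hp f).1 hf
  exact (h7_mem_iff hp _).2 ⟨h'.1.comp_quasiMeasurePreserving (h7_qmp hh),
    (h7_N_shift hp hμ1 f hh).trans_lt h'.2⟩

theorem h7_eLp_shift (hp : 1 < p) (hμ1 : μ ≤ 1) (f : ℝ → E) {h : ℝ} (hh : 0 ≤ h) :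
    eLpNorm (fun t => f (t + h)) (ENNReal.ofReal p) (h7nu p μ)
      ≤ eLpNorm f (ENNReal.ofReal p) (h7nu p μ) := by
  have := h7_N_shift hp hμ1 f hh
  rw [h7_N_eq hp, h7_N_eq hp] at this
  exact (ENNReal.rpow_le_rpow_iff (by linarith)).1 this

theorem h7_lf (hp : 1 < p) (hμ1 : μ ≤ 1) : IsLocallyFiniteMeasure (h7nu p μ) := by
  unfold h7nu
  exact IsLocallyFiniteMeasure.withDensity_ofReal
    (Real.continuous_rpow_const (h7_exp_nonneg hp hμ1))

theorem h7_cc (hp : 1 < p) (hμ1 : μ ≤ 1) {g : ℝ → E} (hg : Continuous g)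
    (hc : HasCompactSupport g) {ε : ℝ≥0∞} (hε : ε ≠ 0) :
    ∃ δ > (0:ℝ), ∀ h, 0 ≤ h → h < δ →
      eLpNorm (fun t => g t - g (t + h)) (ENNReal.ofReal p) (h7nu p μ) ≤ ε := by
  have := h7_lf (p := p) (μ := μ) hp hμ1
  obtain ⟨R, hR⟩ := hc.isCompact.isBounded.subset_closedBall 0
  have hg0 : ∀ t, t ∉ Icc (-R) R → g t = 0 := by
    intro t ht
    refine image_eq_zero_of_notMem_tsupport fun h => ht ?_
    have := hR h
    rwa [Real.closedBall_eq_Icc, zero_sub, zero_add] at this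
  set S := Icc (-R - 1) R with hS
  set K := ((h7nu p μ).restrict S univ) ^ (ENNReal.ofReal p).toReal⁻¹ with hK
  have hKt : K ≠ ∞ := by
    refine ENNReal.rpow_ne_top_of_nonneg (by positivity) ?_
    rw [Measure.restrict_apply_univ]
    exact isCompact_Icc.measure_lt_top.ne
  have hlim : Filter.Tendsto (fun c : ℝ => K * ENNReal.ofReal c) (nhdsWithin 0 (Ioi 0)) (nhds 0) := by
    have h1 : Filter.Tendsto (fun c : ℝ => K * ENNReal.ofReal c) (nhds 0)
        (nhds (K * ENNReal.ofReal 0)) :=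
      ENNReal.Tendsto.const_mul (ENNReal.tendsto_ofReal Filter.tendsto_id) (Or.inr hKt)
    simp only [ENNReal.ofReal_zero, mul_zero] at h1
    exact h1.mono_left nhdsWithin_le_nhds
  obtain ⟨c, hcε, hc0⟩ := ((hlim.eventually (gt_mem_nhds (pos_iff_ne_zero.2 hε))).and
    self_mem_nhdsWithin).exists
  obtain ⟨δ, hδ, huc⟩ := Metric.uniformContinuous_iff.1 (hc.uniformContinuous_of_continuous hg) c hc0
  refine ⟨min δ 1, lt_min hδ one_pos, fun h h0 hlt => ?_⟩
  have hsupp : Function.support (fun t => g t - g (t + h)) ⊆ S := by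
    intro t ht
    by_contra hne
    apply ht
    have h1 : h < 1 := hlt.trans_le (min_le_right _ _)
    beta_reduce
    rw [hg0 t, hg0 (t + h), sub_zero]
    · rintro ⟨h2, h3⟩; exact hne ⟨by linarith, by linarith⟩
    · rintro ⟨h2, h3⟩; exact hne ⟨by linarith, by linarith⟩
  rw [← eLpNorm_restrict_eq_of_support_subset hsupp]
  refine (eLpNorm_le_of_ae_bound (C := c) (Filter.Eventually.of_forall fun t => ?_)).trans hcε.le
  rw [← dist_eq_norm]
  refine (huc ?_).le
  rw [Real.dist_eq, sub_add_cancel_left, abs_neg, abs_of_nonneg h0]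
  exact hlt.trans_le (min_le_left _ _)

theorem h7_cont0 [NormedSpace ℝ E] (hp : 1 < p) (hμ1 : μ ≤ 1) {f : ℝ → E}
    (hf : MemWLp p μ (Ioi 0) f) {ε : ℝ≥0∞} (hε : ε ≠ 0) :
    ∃ δ > (0:ℝ), ∀ h, 0 ≤ h → h < δ →
      eLpNorm (fun t => f t - f (t + h)) (ENNReal.ofReal p) (h7nu p μ) ≤ ε := by
  have := h7_lf (p := p) (μ := μ) hp hμ1
  have hε3 : ε / 3 ≠ 0 := (ENNReal.div_pos hε (by simp)).ne'
  have hP1 : 1 ≤ ENNReal.ofReal p := by simpa using hp.le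
  obtain ⟨g, gc, gle, gcont, gmem⟩ :=
    (h7_memLp hp hf).exists_hasCompactSupport_eLpNorm_sub_le ENNReal.ofReal_ne_top hε3
  obtain ⟨δ, hδ, H⟩ := h7_cc hp hμ1 gcont gc hε3
  refine ⟨δ, hδ, fun h h0 hlt => ?_⟩
  have hfm := (h7_memLp hp hf).1
  have hfs := (h7_memLp hp (h7_mem_shift hp hμ1 hf h0)).1
  have hgm : AEStronglyMeasurable g (h7nu p μ) := gmem.1
  have hgs : AEStronglyMeasurable (fun t => g (t + h)) (h7nu p μ) :=
    (gcont.comp (continuous_add_const h)).aestronglyMeasurable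
  have e : (fun t => f t - f (t + h)) =
      ((f - g) + (fun t => g t - g (t + h))) + (fun t => -((f - g) (t + h))) := by
    ext t; simp
  rw [e]
  refine (eLpNorm_add_le ((hfm.sub hgm).add (hgm.sub hgs)) (hfs.sub hgs).neg hP1).trans ?_
  refine (add_le_add_left (eLpNorm_add_le (hfm.sub hgm) (hgm.sub hgs) hP1) _).trans ?_
  have h3 : eLpNorm (fun t => -((f - g) (t + h))) (ENNReal.ofReal p) (h7nu p μ) ≤ ε / 3 := by
    rw [show (fun t => -((f - g) (t + h))) = -(fun t => (f - g) (t + h)) from rfl, eLpNorm_neg]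
    exact (h7_eLp_shift hp hμ1 (f - g) h0).trans gle
  calc _ ≤ ε / 3 + ε / 3 + ε / 3 := add_le_add (add_le_add gle (H h h0 hlt)) h3
    _ = ε := ENNReal.add_thirds ε

theorem h7_cont [NormedSpace ℝ E] (hp : 1 < p) (hμ1 : μ ≤ 1) {f : ℝ → E}
    (hf : MemWLp p μ (Ioi 0) f) {ε : ℝ≥0∞} (hε : ε ≠ 0) (hεt : ε ≠ ∞) :
    ∃ δ > (0:ℝ), ∀ s, 0 ≤ s → ∀ t, 0 ≤ t → |s - t| < δ →
      h7N p μ (fun r => f (r + s) - f (r + t)) ≤ ε := by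
  have hp0 : 0 < p := by linarith
  obtain ⟨δ, hδ, H⟩ := h7_cont0 hp hμ1 hf (ε := ε ^ (1 / p))
    (by simp [ENNReal.rpow_eq_zero_iff, hε, hεt])
  have H' : ∀ h, 0 ≤ h → h < δ → h7N p μ (fun t => f t - f (t + h)) ≤ ε := by
    intro h h0 h1
    rw [h7_N_eq hp]
    refine (ENNReal.rpow_le_rpow (H h h0 h1) hp0.le).trans ?_
    rw [← ENNReal.rpow_mul, one_div_mul_cancel hp0.ne', ENNReal.rpow_one]
  have H2 : ∀ s, 0 ≤ s → ∀ t, s ≤ t → |s - t| < δ →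
      h7N p μ (fun r => f (r + s) - f (r + t)) ≤ ε := by
    intro s hs t hst hd
    rw [abs_sub_comm, abs_of_nonneg (by linarith)] at hd
    refine le_trans ?_ (H' (t - s) (by linarith) hd)
    refine le_trans (le_of_eq ?_) (h7_N_shift hp hμ1 _ hs)
    congr 1; ext r; congr 2; ring
  refine ⟨δ, hδ, fun s hs t ht hd => ?_⟩
  rcases le_total s t with h | h
  · exact H2 s hs t h hd
  · have e : h7N p μ (fun r => f (r + s) - f (r + t)) = h7N p μ (fun r => f (r + t) - f (r + s)) := by
      unfold h7N
      simp only [enorm_sub_rev]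
    rw [e]
    exact H2 t ht s h (by rwa [abs_sub_comm])

end helpers3

section helpers4

theorem h7_test_int {E : Type*} [NormedAddCommGroup E] [NormedSpace ℝ E] {F : ℝ → E}
    (hF : LocallyIntegrableOn F (Ioi 0)) {ψ : ℝ → ℝ} (h1 : Continuous ψ)
    (h2 : HasCompactSupport ψ) (h3 : tsupport ψ ⊆ Ioi 0) :
    IntegrableOn (fun t => ψ t • F t) (Ioi 0) := by
  have hK : IntegrableOn (fun t => ψ t • F t) (tsupport ψ) :=
    (hF.integrableOn_compact_subset h3 h2.isCompact).continuousOn_smul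
      h1.continuousOn h2.isCompact
  refine hK.of_forall_sdiff_eq_zero measurableSet_Ioi ?_
  rintro x ⟨_, hx⟩
  rw [image_eq_zero_of_notMem_tsupport hx, zero_smul]

theorem h7_loc_shift {E : Type*} [NormedAddCommGroup E] {F : ℝ → E}
    (hF : LocallyIntegrableOn F (Ioi 0)) {h : ℝ} (hh : 0 ≤ h) :
    LocallyIntegrableOn (fun t => F (t + h)) (Ioi 0) := by
  rw [locallyIntegrableOn_iff (isOpen_Ioi.isLocallyClosed)] at hF ⊢
  intro K hK hKc
  have h1 := hF ((fun t => t + h) '' K) (by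
    rintro _ ⟨t, ht, rfl⟩
    exact add_pos_of_pos_of_nonneg (hK ht) hh) (hKc.image (continuous_add_const h))
  exact ((measurePreserving_add_right volume h).integrableOn_image
    (measurableEmbedding_addRight h)).1 h1

theorem h7_wd_shift {E : Type*} [NormedAddCommGroup E] [NormedSpace ℂ E] {f g : ℝ → E}
    (hw : IsWeakDeriv (Ioi 0) f g) {h : ℝ} (hh : 0 ≤ h) :
    IsWeakDeriv (Ioi 0) (fun t => f (t + h)) (fun t => g (t + h)) := by
  refine ⟨h7_loc_shift hw.1 hh, h7_loc_shift hw.2.1 hh, fun φ h1 h2 h3 => ?_⟩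
  have key : ∀ (ψ : ℝ → ℝ) (F : ℝ → E), tsupport ψ ⊆ Ioi 0 →
      ∫ t in Ioi (0:ℝ), ψ t • F (t + h) = ∫ t in Ioi (0:ℝ), ψ (t - h) • F t := by
    intro ψ F hψ
    have hz : ∀ t, t ∉ Ioi (0:ℝ) → ψ t = 0 := fun t ht =>
      image_eq_zero_of_notMem_tsupport fun hh => ht (hψ hh)
    rw [setIntegral_eq_integral_of_forall_compl_eq_zero (fun t ht => by rw [hz t ht, zero_smul]),
      setIntegral_eq_integral_of_forall_compl_eq_zero (fun t ht => by
        rw [hz (t - h), zero_smul]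
        intro h5
        have h6 : 0 < t - h := h5
        exact ht (show 0 < t by linarith)),
      ← integral_add_right_eq_self (fun t => ψ (t - h) • F t) h]
    simp
  have hts : tsupport (fun t => φ (t - h)) = (Homeomorph.subRight h) ⁻¹' tsupport φ :=
    tsupport_comp_eq_preimage φ (Homeomorph.subRight h)
  have := hw.2.2 (fun t => φ (t - h)) (h1.comp (contDiff_id.sub contDiff_const))
    (h2.comp_homeomorph (Homeomorph.subRight h)) (by
      rw [hts]
      intro t ht
      have : 0 < t - h := h3 ht
      exact show 0 < t by linarith)
  rw [key _ _ (tsupport_deriv_subset.trans h3), key _ _ h3, ← this]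
  simp only [deriv_comp_sub_const]

theorem h7_wd_sub {E : Type*} [NormedAddCommGroup E] [NormedSpace ℂ E] {f g f' g' : ℝ → E}
    (hf : IsWeakDeriv (Ioi 0) f f') (hg : IsWeakDeriv (Ioi 0) g g') :
    IsWeakDeriv (Ioi 0) (fun t => f t - g t) (fun t => f' t - g' t) := by
  refine ⟨hf.1.sub hg.1, hf.2.1.sub hg.2.1, fun φ h1 h2 h3 => ?_⟩
  have hd : Continuous (deriv φ) := h1.continuous_deriv (by simp)
  have hs := tsupport_deriv_subset.trans h3
  simp only [smul_sub]
  rw [integral_sub (h7_test_int hf.1 hd h2.deriv hs) (h7_test_int hg.1 hd h2.deriv hs),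
    integral_sub (h7_test_int hf.2.1 h1.continuous h2 h3) (h7_test_int hg.2.1 h1.continuous h2 h3),
    hf.2.2 φ h1 h2 h3, hg.2.2 φ h1 h2 h3]
  abel

variable {Y₀ Y₁ : Type*} [NormedAddCommGroup Y₀] [NormedSpace ℂ Y₀] [CompleteSpace Y₀]
  [NormedAddCommGroup Y₁] [NormedSpace ℂ Y₁] [CompleteSpace Y₁]

theorem h7_memE_shift {p μ : ℝ} (hp : 1 < p) (hμ1 : μ ≤ 1) {ι : Y₁ →L[ℂ] Y₀} {u : ℝ → Y₁}
    {u' : ℝ → Y₀} (hu : MemE p μ (Ioi 0) ι u u') {h : ℝ} (hh : 0 ≤ h) :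
    MemE p μ (Ioi 0) ι (fun t => u (t + h)) (fun t => u' (t + h)) :=
  ⟨h7_mem_shift hp hμ1 hu.1 hh, h7_mem_shift hp hμ1 hu.2.1 hh, h7_mem_shift hp hμ1 hu.2.2.1 hh,
    h7_wd_shift hu.2.2.2 hh⟩

theorem h7_memE_sub {p μ : ℝ} (hp : 1 < p) {ι : Y₁ →L[ℂ] Y₀} {u v : ℝ → Y₁}
    {u' v' : ℝ → Y₀} (hu : MemE p μ (Ioi 0) ι u u') (hv : MemE p μ (Ioi 0) ι v v') :
    MemE p μ (Ioi 0) ι (fun t => u t - v t) (fun t => u' t - v' t) := by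
  refine ⟨h7_mem_sub hp hu.1 hv.1, ?_, h7_mem_sub hp hu.2.2.1 hv.2.2.1, ?_⟩
  · simpa only [map_sub] using h7_mem_sub hp hu.2.1 hv.2.1
  · simpa only [map_sub] using h7_wd_sub hu.2.2.2 hv.2.2.2

theorem h7_eNorm_eq {p μ : ℝ} (hp : 1 < p) {ι : Y₁ →L[ℂ] Y₀} {u : ℝ → Y₁}
    {u' : ℝ → Y₀} (hu : MemE p μ (Ioi 0) ι u u') :
    eNorm p μ (Ioi 0) u u' = ((h7N p μ u).toReal + (h7N p μ u').toReal) ^ (1 / p) := by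
  unfold eNorm
  rw [h7_norm_eq hp hu.1, h7_norm_eq hp hu.2.2.1]

theorem h7_trace_le {p μ : ℝ} (hp : 1 < p) {ι : Y₁ →L[ℂ] Y₀} {u : ℝ → Y₁}
    {u' : ℝ → Y₀} (hu : MemE p μ (Ioi 0) ι u u') {x : Y₀}
    (hx : HasTrace (Ioi 0) (fun t => ι (u t)) x) :
    traceNorm p μ ι x ≤ eNorm p μ (Ioi 0) u u' := by
  refine csInf_le ⟨0, ?_⟩ ⟨u, u', hu, hx, rfl⟩
  rintro r ⟨v, v', hv, -, rfl⟩
  rw [h7_eNorm_eq hp hv]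
  positivity

end helpers4

/-- **Trace embedding of the maximal regularity class, Prüss–Simonett 2004,
Prop. 3.1.** Let `1 < p < ∞`, `μ ∈ (1/p,1]`. There is `C > 0` such that for every
`u ∈ E_{1,μ} = W^1_{p,μ}(ℝ₊;X₀) ∩ L_{p,μ}(ℝ₊;X₁)` (with weak derivative `u'`), the
continuous representative `w` of `u` takes values in the trace space `X_{γ,μ}` on `[0,∞)`,
is bounded and uniformly continuous from `[0,∞)` into `X_{γ,μ}` with its trace norm, and
`sup_{t ≥ 0} ‖w t‖_{X_{γ,μ}} ≤ C ‖u‖_{E_{1,μ}}`. -/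
theorem statement7 (p μ : ℝ) (hp : 1 < p) (hμ : 1 / p < μ) (hμ1 : μ ≤ 1)
    (ι : X₁ →L[ℂ] X₀) (hinj : Function.Injective ι) (hdense : DenseRange ι) :
    ∃ C > (0 : ℝ), ∀ (u : ℝ → X₁) (u' : ℝ → X₀), MemE p μ (Set.Ioi 0) ι u u' →
      ∃ w : ℝ → X₀,
        ContinuousOn w (Set.Ici 0) ∧
        (∀ᵐ t ∂(volume.restrict (Set.Ioi 0)), w t = ι (u t)) ∧
        (∀ t ∈ Set.Ici (0 : ℝ), InTrace p μ ι (w t)) ∧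
        (∀ ε > (0 : ℝ), ∃ δ > (0 : ℝ), ∀ s ∈ Set.Ici (0 : ℝ), ∀ t ∈ Set.Ici (0 : ℝ),
          |s - t| < δ → traceNorm p μ ι (w s - w t) < ε) ∧
        ∀ t ∈ Set.Ici (0 : ℝ), traceNorm p μ ι (w t) ≤ C * eNorm p μ (Set.Ioi 0) u u' := by
  have hp0 : 0 < p := by linarith
  refine ⟨1, one_pos, fun u u' hu => ?_⟩
  obtain ⟨w, hwc, hwe⟩ := h7_rep hp hμ hu.2.2.1 hu.2.2.2
  have hcs : ∀ t, 0 ≤ t → ContinuousOn (fun r => w (r + t)) (insert 0 (Ioi 0)) := by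
    intro t ht
    refine hwc.comp (continuous_add_const t).continuousOn ?_
    intro r hr
    have hr0 : 0 ≤ r := by
      rcases hr with rfl | hr
      · exact le_rfl
      · exact le_of_lt hr
    exact add_nonneg hr0 ht
  have hes : ∀ t, 0 ≤ t → ∀ᵐ r ∂(volume.restrict (Ioi (0:ℝ))), w (r + t) = ι (u (r + t)) :=
    fun t ht => (h7_qmp ht).ae hwe
  have htr : ∀ t, 0 ≤ t → HasTrace (Ioi 0) (fun r => ι (u (r + t))) (w t) :=
    fun t ht => ⟨fun r => w (r + t), hcs t ht, hes t ht, by simp⟩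
  refine ⟨w, hwc, hwe, fun t ht => ⟨_, _, h7_memE_shift hp hμ1 hu ht, htr t ht⟩, ?_, ?_⟩
  · intro ε hε
    have hεp : 0 < ε ^ p := Real.rpow_pos_of_pos hε p
    have hq : ENNReal.ofReal (ε ^ p / 4) ≠ 0 := by
      simp only [ne_eq, ENNReal.ofReal_eq_zero, not_le]; positivity
    obtain ⟨δ₁, hδ₁, H₁⟩ := h7_cont hp hμ1 hu.1 hq ENNReal.ofReal_ne_top
    obtain ⟨δ₂, hδ₂, H₂⟩ := h7_cont hp hμ1 hu.2.2.1 hq ENNReal.ofReal_ne_top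
    refine ⟨min δ₁ δ₂, lt_min hδ₁ hδ₂, fun s hs t ht hd => ?_⟩
    have hE := h7_memE_sub hp (h7_memE_shift hp hμ1 hu hs) (h7_memE_shift hp hμ1 hu ht)
    refine (h7_trace_le hp hE ?_).trans_lt ?_
    · refine ⟨fun r => w (r + s) - w (r + t), (hcs s hs).sub (hcs t ht), ?_, by simp⟩
      filter_upwards [hes s hs, hes t ht] with r h1 h2
      rw [h1, h2, map_sub]
    · rw [h7_eNorm_eq hp hE]
      have a1 := ENNReal.toReal_le_of_le_ofReal (by positivity)
        (H₁ s hs t ht (hd.trans_le (min_le_left _ _)))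
      have a2 := ENNReal.toReal_le_of_le_ofReal (by positivity)
        (H₂ s hs t ht (hd.trans_le (min_le_right _ _)))
      have e : ε = (ε ^ p) ^ (1 / p) := by
        rw [← Real.rpow_mul hε.le, mul_one_div_cancel hp0.ne', Real.rpow_one]
      rw [e]
      refine Real.rpow_lt_rpow (by positivity) ?_ (by positivity)
      linarith
  · intro t ht
    have hE := h7_memE_shift hp hμ1 hu ht
    rw [one_mul]
    refine (h7_trace_le hp hE (htr t ht)).trans ?_
    rw [h7_eNorm_eq hp hE, h7_eNorm_eq hp hu]
    have f1 := ((h7_mem_iff hp _).1 hu.1).2.ne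
    have f2 := ((h7_mem_iff hp _).1 hu.2.2.1).2.ne
    have g1 := ENNReal.toReal_mono f1 (h7_N_shift hp hμ1 u ht)
    have g2 := ENNReal.toReal_mono f2 (h7_N_shift hp hμ1 u' ht)
    exact Real.rpow_le_rpow (by positivity) (add_le_add g1 g2) (by positivity)
end
end

section
/- (Maximal regularity on finite intervals with a uniform constant.) Let 1<p<∞, μ∈(1/p,1] and A ∈ MR_p(X_0). Then there exists a constant C>0 such that for every T ∈ (0,∞) and every f ∈ L_{p,μ}((0,T);X_0) there exists a unique u ∈ E_{1,μ}(0,T) with u̇(t)+Au(t)=f(t) for a.e. t ∈ (0,T) and u(0)=0, and this solution satisfies ‖u‖_{E_{1,μ}(0,T)} ≤ C ‖f‖_{L_{p,μ}((0,T);X_0)} with C independent of T and f. -/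
open MeasureTheory Set

noncomputable section

variable {X₀ X₁ : Type*} [NormedAddCommGroup X₀] [NormedSpace ℂ X₀] [CompleteSpace X₀]
  [NormedAddCommGroup X₁] [NormedSpace ℂ X₁] [CompleteSpace X₁]

theorem aux_prod_int {X : Type*} [NormedAddCommGroup X] [NormedSpace ℝ X] [CompleteSpace X]
    (h : ℝ → ℝ) (g : ℝ → X) (c t : ℝ) (ht : 0 ≤ t)
    (hh : IntervalIntegrable h volume 0 t) (hg : IntervalIntegrable g volume 0 t) :
    (c + ∫ s in (0:ℝ)..t, h s) • (∫ s in (0:ℝ)..t, g s) =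
      ∫ s in (0:ℝ)..t, ((c + ∫ r in (0:ℝ)..s, h r) • g s + h s • ∫ r in (0:ℝ)..s, g r) := by
  have hcH : ContinuousOn (fun s => ∫ r in (0:ℝ)..s, h r) (uIcc 0 t) :=
    intervalIntegral.continuousOn_primitive_interval' hh (by simp)
  have hcG : ContinuousOn (fun s => ∫ r in (0:ℝ)..s, g r) (uIcc 0 t) :=
    intervalIntegral.continuousOn_primitive_interval' hg (by simp)
  have i1 : IntervalIntegrable (fun s => (c + ∫ r in (0:ℝ)..s, h r) • g s) volume 0 t :=
    hg.continuousOn_smul (continuousOn_const.add hcH)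
  have i2 : IntervalIntegrable (fun s => h s • ∫ r in (0:ℝ)..s, g r) volume 0 t :=
    hh.smul_continuousOn hcG
  rw [intervalIntegral.integral_add i1 i2]
  have key : (∫ s in (0:ℝ)..t, h s • ∫ r in (0:ℝ)..s, g r) =
      ∫ s in (0:ℝ)..t, (∫ r in s..t, h r) • g s := by
    simp only [intervalIntegral.integral_of_le ht]
    have hint : Integrable (Function.uncurry fun s r : ℝ =>
        ({q : ℝ × ℝ | q.2 ≤ q.1}.indicator (fun q => h q.1 • g q.2)) (s, r))
        ((volume.restrict (Ioc 0 t)).prod (volume.restrict (Ioc 0 t))) := by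
      have : Integrable (fun q : ℝ × ℝ => h q.1 • g q.2)
          ((volume.restrict (Ioc 0 t)).prod (volume.restrict (Ioc 0 t))) :=
        Integrable.smul_prod (hh.1) (hg.1)
      exact this.indicator (measurableSet_le measurable_snd measurable_fst)
    have sw := integral_integral_swap hint
    have l : ∀ s ∈ Ioc 0 t, (h s • ∫ r in (0:ℝ)..s, g r) =
        ∫ r in Ioc 0 t, ({q : ℝ × ℝ | q.2 ≤ q.1}.indicator (fun q => h q.1 • g q.2)) (s, r) := by
      intro s hs
      have e : (fun r => ({q : ℝ × ℝ | q.2 ≤ q.1}.indicator (fun q => h q.1 • g q.2)) (s, r))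
          = (Iic s).indicator (fun r => h s • g r) := by
        ext r; simp [indicator]
      rw [e, setIntegral_indicator measurableSet_Iic, integral_smul,
        intervalIntegral.integral_of_le hs.1.le]
      congr 3
      ext r; simp only [mem_Ioc, mem_inter_iff, mem_Iic]; grind
    have r' : ∀ s ∈ Ioc 0 t, ((∫ r in s..t, h r) • g s) =
        ∫ r in Ioc 0 t, ({q : ℝ × ℝ | q.2 ≤ q.1}.indicator (fun q => h q.1 • g q.2)) (r, s) := by
      intro s hs
      have e : (fun r => ({q : ℝ × ℝ | q.2 ≤ q.1}.indicator (fun q => h q.1 • g q.2)) (r, s))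
          = (Ici s).indicator (fun r => h r • g s) := by
        ext r; simp [indicator]
      rw [e, setIntegral_indicator measurableSet_Ici, integral_smul_const,
        intervalIntegral.integral_of_le hs.2, ← integral_Icc_eq_integral_Ioc]
      congr 3
      ext r; simp only [mem_Ioc, mem_inter_iff, mem_Ici, mem_Icc]; grind
    rw [setIntegral_congr_fun measurableSet_Ioc l, setIntegral_congr_fun measurableSet_Ioc r', sw]
  have i3 : IntervalIntegrable (fun s => (∫ r in s..t, h r) • g s) volume 0 t := by
    apply hg.continuousOn_smul
    apply ContinuousOn.congr (continuousOn_const (c := ∫ r in (0:ℝ)..t, h r) |>.sub hcH)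
    intro s hs
    show (∫ r in s..t, h r) = (∫ r in (0:ℝ)..t, h r) - ∫ r in (0:ℝ)..s, h r
    rw [eq_sub_iff_add_eq, add_comm]
    apply intervalIntegral.integral_add_adjacent_intervals
    · exact hh.mono_set (uIcc_subset_uIcc_left hs)
    · exact hh.mono_set (uIcc_subset_uIcc_right hs)
  rw [key, ← intervalIntegral.integral_add i1 i3, ← intervalIntegral.integral_smul]
  apply intervalIntegral.integral_congr
  intro s hs
  simp only
  rw [← add_smul, add_assoc]
  congr 2
  symm
  apply intervalIntegral.integral_add_adjacent_intervals
  · exact hh.mono_set (uIcc_subset_uIcc_left hs)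
  · exact hh.mono_set (uIcc_subset_uIcc_right hs)

theorem aux_swap (κ : ℝ) (hκ : 0 < κ) (b : ℝ → ENNReal) (hb : AEMeasurable b) :
    ∫⁻ t in Ioi (0:ℝ), ENNReal.ofReal (κ * t ^ (-κ - 1)) * ∫⁻ s in Ioo 0 t, b s =
      ∫⁻ s in Ioi (0:ℝ), ENNReal.ofReal (s ^ (-κ)) * b s := by
  have h1 : ∀ s ∈ Ioi (0:ℝ), ∫⁻ t in Ioi s, ENNReal.ofReal (κ * t ^ (-κ - 1)) =
      ENNReal.ofReal (s ^ (-κ)) := by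
    intro s hs
    rw [← ofReal_integral_eq_lintegral_ofReal]
    · rw [integral_const_mul, integral_Ioi_rpow_of_lt (by linarith) hs]
      congr 1
      simp only [sub_add_cancel]; field_simp
    · exact (integrableOn_Ioi_rpow_of_lt (by linarith) hs).const_mul _
    · refine (ae_restrict_iff' measurableSet_Ioi).2 (.of_forall fun t ht => ?_)
      have : 0 < t := lt_trans hs ht
      simp only [Pi.zero_apply]; positivity
  have hm : Measurable fun t : ℝ => ENNReal.ofReal (κ * t ^ (-κ - 1)) := by fun_prop
  have e1 : ∀ t ∈ Ioi (0:ℝ), ENNReal.ofReal (κ * t ^ (-κ - 1)) * ∫⁻ s in Ioo 0 t, b s =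
      ∫⁻ s in Ioi (0:ℝ), ({q : ℝ × ℝ | q.2 < q.1}.indicator
        (fun q => ENNReal.ofReal (κ * q.1 ^ (-κ - 1)) * b q.2)) (t, s) := by
    intro t ht
    have e : (fun s => ({q : ℝ × ℝ | q.2 < q.1}.indicator
        (fun q => ENNReal.ofReal (κ * q.1 ^ (-κ - 1)) * b q.2)) (t, s)) =
        (Iio t).indicator (fun s => ENNReal.ofReal (κ * t ^ (-κ - 1)) * b s) := by
      ext s; simp [indicator]
    rw [e, setLIntegral_indicator measurableSet_Iio, lintegral_const_mul'' _ hb.restrict]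
    congr 3
    ext r; simp; grind
  have e2 : ∀ s ∈ Ioi (0:ℝ), ENNReal.ofReal (s ^ (-κ)) * b s =
      ∫⁻ t in Ioi (0:ℝ), ({q : ℝ × ℝ | q.2 < q.1}.indicator
        (fun q => ENNReal.ofReal (κ * q.1 ^ (-κ - 1)) * b q.2)) (t, s) := by
    intro s hs
    have e : (fun t => ({q : ℝ × ℝ | q.2 < q.1}.indicator
        (fun q => ENNReal.ofReal (κ * q.1 ^ (-κ - 1)) * b q.2)) (t, s)) =
        (Ioi s).indicator (fun t => ENNReal.ofReal (κ * t ^ (-κ - 1)) * b s) := by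
      ext s; simp [indicator]
    rw [e, setLIntegral_indicator measurableSet_Ioi, lintegral_mul_const _ hm, ← h1 s hs]
    congr 3
    ext r; have := mem_Ioi.1 hs; simp; grind
  rw [setLIntegral_congr_fun measurableSet_Ioi e1, setLIntegral_congr_fun measurableSet_Ioi e2]
  apply lintegral_lintegral_swap
  apply AEMeasurable.indicator _ (measurableSet_lt measurable_snd measurable_fst)
  apply AEMeasurable.mul
  · exact (hm.comp measurable_fst).aemeasurable
  · exact hb.restrict.comp_snd

theorem aux_decr (κ : ℝ) (hκ : 0 < κ) (a b : ℝ → ENNReal) (ha : AEMeasurable a)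
    (hb : AEMeasurable b) (K : ENNReal) (hK : K ≠ ⊤)
    (h : ∀ s > 0, ∫⁻ t in Ioo 0 s, a t ≤ K * ∫⁻ t in Ioo 0 s, b t) :
    ∫⁻ s in Ioi (0:ℝ), ENNReal.ofReal (s ^ (-κ)) * a s ≤
      K * ∫⁻ s in Ioi (0:ℝ), ENNReal.ofReal (s ^ (-κ)) * b s := by
  rw [← aux_swap κ hκ a ha, ← aux_swap κ hκ b hb, ← lintegral_const_mul' _ _ hK]
  apply setLIntegral_mono' measurableSet_Ioi
  intro t ht
  calc _ ≤ ENNReal.ofReal (κ * t ^ (-κ - 1)) * (K * ∫⁻ t in Ioo 0 t, b t) := by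
        gcongr; exact h t ht
    _ = _ := by ring

theorem aux_hardy (p α : ℝ) (hp : 1 < p) (hα : α < 1 - 1 / p) :
    ∃ K : ENNReal, K ≠ ⊤ ∧ ∀ g : ℝ → ENNReal, AEMeasurable g →
      ∫⁻ t in Ioi (0:ℝ), ENNReal.ofReal (t ^ (-((1 - α) * p))) * (∫⁻ s in Ioo 0 t, g s) ^ p ≤
        K * ∫⁻ t in Ioi (0:ℝ), ENNReal.ofReal (t ^ (α * p)) * g t ^ p := by
  obtain ⟨β, hβ1, hβ2⟩ := exists_between hα
  have hp0 : 0 < p := by linarith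
  set q := p / (p - 1) with hq
  have hpq : q.HolderConjugate p := (Real.HolderConjugate.conjExponent hp).symm
  have hq0 : 0 < q := hpq.pos
  have hp1 : 0 < p - 1 := by linarith
  have hβq : 0 < 1 - β * q := by
    have : β < (p - 1) / p := by rw [sub_div, div_self hp0.ne']; exact hβ2
    have : β * q < 1 := by
      rw [hq, ← mul_div_assoc, div_lt_one hp1]
      exact (lt_div_iff₀ hp0).1 this
    linarith
  set κ := (β - α) * p with hκ
  have hκ0 : 0 < κ := mul_pos (by linarith) hp0
  have hqe : (1 - β * q) * (p - 1) = (p - 1) - β * p := by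
    rw [hq]; field_simp
  have I1 : ∀ t > 0, ∫⁻ s in Ioo (0:ℝ) t, ENNReal.ofReal (s ^ (-β)) ^ q =
      ENNReal.ofReal (t ^ (1 - β * q) / (1 - β * q)) := by
    intro t ht
    have : ∀ s ∈ Ioo (0:ℝ) t, ENNReal.ofReal (s ^ (-β)) ^ q = ENNReal.ofReal (s ^ (-β * q)) := by
      intro s hs
      have hs0 := hs.1
      rw [ENNReal.ofReal_rpow_of_nonneg (by positivity) hq0.le, ← Real.rpow_mul hs0.le]
    rw [setLIntegral_congr_fun measurableSet_Ioo this, ← ofReal_integral_eq_lintegral_ofReal]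
    · rw [← integral_Ioc_eq_integral_Ioo, ← intervalIntegral.integral_of_le ht.le,
        integral_rpow (Or.inl (by linarith))]
      congr 1
      rw [Real.zero_rpow (by linarith)]
      ring_nf
    · have := (intervalIntegral.intervalIntegrable_rpow' (r := -β * q) (by linarith) (a := 0) (b := t)).1
      exact this.mono_set Ioo_subset_Ioc_self
    · refine (ae_restrict_iff' measurableSet_Ioo).2 (.of_forall fun s hs => ?_)
      have : 0 < s := hs.1
      simp only [Pi.zero_apply]; positivity
  set c : ℝ := (1 / (1 - β * q)) ^ (p - 1) with hc
  have hc0 : 0 < c := by positivity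
  refine ⟨ENNReal.ofReal (c / κ), ENNReal.ofReal_ne_top, fun g hg => ?_⟩
  have mβ : ∀ γ : ℝ, Measurable fun s : ℝ => ENNReal.ofReal (s ^ γ) := fun γ => by fun_prop
  set b : ℝ → ENNReal := fun s => (ENNReal.ofReal (s ^ β) * g s) ^ p with hb
  have hbm : AEMeasurable b := (((mβ β).aemeasurable).mul hg).pow_const p
  have main : ∀ t ∈ Ioi (0:ℝ), ENNReal.ofReal (t ^ (-((1 - α) * p))) * (∫⁻ s in Ioo 0 t, g s) ^ p ≤
      ENNReal.ofReal (c / κ) * (ENNReal.ofReal (κ * t ^ (-κ - 1)) * ∫⁻ s in Ioo 0 t, b s) := by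
    intro t ht
    have ht0 : 0 < t := ht
    have e : ∫⁻ s in Ioo 0 t, g s =
        ∫⁻ s in Ioo 0 t, ((fun s => ENNReal.ofReal (s ^ (-β))) *
          (fun s => ENNReal.ofReal (s ^ β) * g s)) s := by
      apply setLIntegral_congr_fun measurableSet_Ioo
      intro s hs
      have hs0 : 0 < s := hs.1
      simp only [Pi.mul_apply]
      rw [← mul_assoc, ← ENNReal.ofReal_mul (by positivity), ← Real.rpow_add hs0]
      simp
    have H := ENNReal.lintegral_mul_le_Lp_mul_Lq (volume.restrict (Ioo 0 t)) hpq
      (mβ (-β)).aemeasurable ((((mβ β).aemeasurable).mul hg).restrict)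
    have H2 : (∫⁻ s in Ioo 0 t, g s) ^ p ≤
        ENNReal.ofReal (c * t ^ ((p - 1) - β * p)) * ∫⁻ s in Ioo 0 t, b s := by
      rw [e]
      refine (ENNReal.rpow_le_rpow H hp0.le).trans (le_of_eq ?_)
      rw [ENNReal.mul_rpow_of_nonneg _ _ hp0.le, I1 t ht0, ← ENNReal.rpow_mul, ← ENNReal.rpow_mul]
      have : 1 / q * p = p - 1 := by rw [hq]; field_simp
      rw [this, one_div_mul_cancel hp0.ne', ENNReal.rpow_one,
        ENNReal.ofReal_rpow_of_nonneg (by positivity) hp1.le, ← hqe]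
      congr 2
      rw [Real.rpow_mul ht0.le, hc, ← Real.mul_rpow (by positivity) (by positivity)]
      congr 1; ring
    refine (mul_le_mul_right H2 _).trans (le_of_eq ?_)
    rw [← mul_assoc, ← mul_assoc, ← ENNReal.ofReal_mul (by positivity),
      ← ENNReal.ofReal_mul (by positivity)]
    congr 2
    rw [mul_left_comm, ← Real.rpow_add ht0, hκ]
    have : -((1 - α) * p) + (p - 1 - β * p) = -((β - α) * p) - 1 := by ring
    rw [this]
    have : β - α ≠ 0 := by linarith
    field_simp
  refine (setLIntegral_mono' measurableSet_Ioi main).trans ?_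
  rw [lintegral_const_mul' _ _ ENNReal.ofReal_ne_top, aux_swap κ hκ0 b hbm]
  apply le_of_eq
  congr 1
  apply setLIntegral_congr_fun measurableSet_Ioi
  intro s hs
  have hs0 : 0 < s := hs
  simp only [hb]
  rw [ENNReal.mul_rpow_of_nonneg _ _ hp0.le, ENNReal.ofReal_rpow_of_nonneg (by positivity) hp0.le,
    ← mul_assoc, ← ENNReal.ofReal_mul (by positivity), ← Real.rpow_mul hs0.le, ← Real.rpow_add hs0]
  congr 3
  rw [hκ]; ring

theorem aux_memW_iff {X : Type*} [NormedAddCommGroup X] [NormedSpace ℝ X] (p μ : ℝ) (hp : 1 < p)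
    (s : Set ℝ) (hs : MeasurableSet s) (hs0 : s ⊆ Ioi 0) (f : ℝ → X) :
    MemWLp p μ s f ↔
      MemLp (fun t => t ^ (1 - μ) • f t) (ENNReal.ofReal p) (volume.restrict s) := by
  have hp0 : 0 < p := by linarith
  have hm : Measurable fun t : ℝ => t ^ (1 - μ) := by fun_prop
  have hm' : Measurable fun t : ℝ => t ^ (-(1 - μ)) := by fun_prop
  have key : AEStronglyMeasurable f (volume.restrict s) ↔
      AEStronglyMeasurable (fun t => t ^ (1 - μ) • f t) (volume.restrict s) := by
    constructor
    · intro h; exact hm.aestronglyMeasurable.smul h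
    · intro h
      refine (hm'.aestronglyMeasurable.smul h).congr ?_
      refine (ae_restrict_iff' hs).2 (.of_forall fun t ht => ?_)
      have : 0 < t := hs0 ht
      simp only [Pi.smul_apply', ← mul_smul, ← Real.rpow_add this]
      simp
  have key2 : IntegrableOn (fun t : ℝ => (t ^ (1 - μ) * ‖f t‖) ^ p) s ↔
      IntegrableOn (fun t : ℝ => ‖t ^ (1 - μ) • f t‖ ^ p) s := by
    apply integrableOn_congr_fun _ hs
    intro t ht
    have : 0 < t := hs0 ht
    simp only [norm_smul, Real.norm_eq_abs]
    rw [abs_of_pos (by positivity)]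
  unfold MemWLp
  rw [key, key2]
  constructor
  · rintro ⟨h1, h2⟩
    rw [← integrable_norm_rpow_iff h1 (by simpa using hp0) (by simp), ENNReal.toReal_ofReal hp0.le]
    exact h2
  · intro h
    refine ⟨h.1, ?_⟩
    have := (integrable_norm_rpow_iff h.1 (by simpa using hp0) (by simp)).2 h
    rw [ENNReal.toReal_ofReal hp0.le] at this
    exact this

theorem aux_wLpNorm {X : Type*} [NormedAddCommGroup X] [NormedSpace ℝ X] (p μ : ℝ) (hp : 1 < p)
    (s : Set ℝ) (hs : MeasurableSet s) (hs0 : s ⊆ Ioi 0) (f : ℝ → X) (hf : MemWLp p μ s f) :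
    wLpNorm p μ s f =
      (eLpNorm (fun t => t ^ (1 - μ) • f t) (ENNReal.ofReal p) (volume.restrict s)).toReal := by
  have hp0 : 0 < p := by linarith
  rw [aux_memW_iff p μ hp s hs hs0] at hf
  rw [hf.eLpNorm_eq_integral_rpow_norm (by simpa using hp0) (by simp), ENNReal.toReal_ofReal
    (by positivity), ENNReal.toReal_ofReal hp0.le, wLpNorm, one_div]
  congr 1
  apply setIntegral_congr_fun hs
  intro t ht
  have : 0 < t := hs0 ht
  simp only [norm_smul, Real.norm_eq_abs]
  rw [abs_of_pos (by positivity)]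

/-- initial open segments -/
structure InitSeg (s : Set ℝ) : Prop where
  op : IsOpen s
  pos : s ⊆ Ioi 0
  ne : s.Nonempty
  seg : ∀ t ∈ s, Ioc 0 t ⊆ s

theorem initSeg_Ioi : InitSeg (Ioi (0:ℝ)) :=
  ⟨isOpen_Ioi, le_rfl, ⟨1, by simp⟩, fun _ _ _ hr => hr.1⟩

theorem initSeg_Ioo (T : ℝ) (hT : 0 < T) : InitSeg (Ioo (0:ℝ) T) :=
  ⟨isOpen_Ioo, fun _ h => h.1, ⟨T/2, by simp; linarith⟩, fun _ ht _ hr => ⟨hr.1, hr.2.trans_lt ht.2⟩⟩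

theorem InitSeg.mS {s : Set ℝ} (h : InitSeg s) : MeasurableSet s := h.op.measurableSet

theorem InitSeg.exists_gt {s : Set ℝ} (h : InitSeg s) {t : ℝ} (ht : t ∈ s) : ∃ r ∈ s, t < r := by
  have := h.op.mem_nhds ht
  obtain ⟨ε, hε, hb⟩ := Metric.mem_nhds_iff.1 this
  refine ⟨t + ε / 2, hb ?_, by linarith⟩
  simp [abs_of_pos, hε]

theorem aux_contOn_prim {X : Type*} [NormedAddCommGroup X] [NormedSpace ℝ X]
    {s : Set ℝ} (hs : InitSeg s) {g : ℝ → X} (hg : ∀ t ∈ s, IntervalIntegrable g volume 0 t) :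
    ContinuousOn (fun t => ∫ r in (0:ℝ)..t, g r) (insert 0 s) := by
  intro t ht
  have : ∃ r ∈ s, t < r := by
    rcases ht with rfl | ht
    · obtain ⟨r, hr⟩ := hs.ne; exact ⟨r, hr, hs.pos hr⟩
    · exact hs.exists_gt ht
  obtain ⟨r, hr, htr⟩ := this
  have ht0 : 0 ≤ t := by
    rcases ht with rfl | ht
    · exact le_rfl
    · exact (hs.pos ht).le
  have hc := intervalIntegral.continuousOn_primitive_interval' (hg r hr) (by simp : (0:ℝ) ∈ uIcc 0 r)
  rw [uIcc_of_le (hs.pos hr).le] at hc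
  have h1 := hc t ⟨ht0, htr.le⟩
  refine h1.mono_of_mem_nhdsWithin ?_
  have h2 : Iio r ∈ nhdsWithin t (insert 0 s) := mem_nhdsWithin_of_mem_nhds (Iio_mem_nhds htr)
  filter_upwards [h2, self_mem_nhdsWithin] with x hx hx2
  refine ⟨?_, le_of_lt hx⟩
  rcases hx2 with rfl | hx2
  · exact le_rfl
  · exact (hs.pos hx2).le

theorem aux_locInt {X : Type*} [NormedAddCommGroup X] {s : Set ℝ} (hs : InitSeg s) {g : ℝ → X}
    (hg : ∀ t ∈ s, IntervalIntegrable g volume 0 t) : LocallyIntegrableOn g s := by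
  intro t ht
  obtain ⟨r, hr, htr⟩ := hs.exists_gt ht
  refine ⟨Ioc 0 r, ?_, (hg r hr).1⟩
  have h2 : Iio r ∈ nhdsWithin t s := mem_nhdsWithin_of_mem_nhds (Iio_mem_nhds htr)
  filter_upwards [h2, self_mem_nhdsWithin] with x hx hx2
  exact ⟨hs.pos hx2, le_of_lt hx⟩

theorem aux_beyond {s : Set ℝ} (hs : InitSeg s) {K : Set ℝ} (hK : IsCompact K) (hKs : K ⊆ s) :
    ∃ r ∈ s, ∀ x ∈ K, x < r := by
  rcases K.eq_empty_or_nonempty with rfl | hne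
  · obtain ⟨r, hr⟩ := hs.ne; exact ⟨r, hr, by simp⟩
  · obtain ⟨m, hm, hmax⟩ := hK.exists_isGreatest hne
    obtain ⟨r, hr, hmr⟩ := hs.exists_gt (hKs hm)
    exact ⟨r, hr, fun x hx => (hmax hx).trans_lt hmr⟩

/-- integral over s of function supported on tsupport φ equals integral `0..r`. -/
theorem aux_setInt_eq {X : Type*} [NormedAddCommGroup X] [NormedSpace ℝ X] {s : Set ℝ}
    (hs : InitSeg s) {r : ℝ} (hr : r ∈ s) (F : ℝ → X) (hF : ∀ x, r ≤ x → F x = 0) :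
    ∫ t in s, F t = ∫ t in (0:ℝ)..r, F t := by
  rw [intervalIntegral.integral_of_le (hs.pos hr).le]
  apply setIntegral_eq_of_subset_of_forall_sdiff_eq_zero hs.mS (hs.seg r hr)
  intro x hx
  apply hF
  by_contra h
  exact hx.2 ⟨hs.pos hx.1, (not_le.1 h).le⟩

theorem aux_weak_of_int {X : Type*} [NormedAddCommGroup X] [NormedSpace ℝ X] [CompleteSpace X]
    {s : Set ℝ} (hs : InitSeg s) {g : ℝ → X} (hg : ∀ t ∈ s, IntervalIntegrable g volume 0 t)
    (φ : ℝ → ℝ) (hφ : ContDiff ℝ (⊤ : ℕ∞) φ) (hc : HasCompactSupport φ) (hsup : tsupport φ ⊆ s) :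
    (∫ t in s, deriv φ t • ∫ r in (0:ℝ)..t, g r) = -∫ t in s, φ t • g t := by
  obtain ⟨r, hr, hbig⟩ := aux_beyond hs hc hsup
  have hr0 : 0 < r := hs.pos hr
  have z1 : ∀ x, r ≤ x → φ x = 0 := fun x hx =>
    image_eq_zero_of_notMem_tsupport fun h => absurd (hbig x h) (not_lt.2 hx)
  have z2 : ∀ x, r ≤ x → deriv φ x = 0 := fun x hx => by
    by_contra h
    have := support_deriv_subset (f := φ) h
    exact absurd (hbig x this) (not_lt.2 hx)
  have z0 : φ 0 = 0 := image_eq_zero_of_notMem_tsupport fun h => lt_irrefl (0:ℝ) (hs.pos (hsup h))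
  rw [aux_setInt_eq hs hr _ (fun x hx => by rw [z2 x hx, zero_smul]),
    aux_setInt_eq hs hr _ (fun x hx => by rw [z1 x hx, zero_smul])]
  have hd : Continuous (deriv φ) := hφ.continuous_deriv (by simp)
  have ftc : ∀ x, ∫ y in (0:ℝ)..x, deriv φ y = φ x := by
    intro x
    rw [intervalIntegral.integral_deriv_eq_sub (fun y _ => (hφ.differentiable (by simp)).differentiableAt)
      (hd.intervalIntegrable _ _), z0, sub_zero]
  have := aux_prod_int (deriv φ) g 0 r hr0.le (hd.intervalIntegrable _ _) (hg r hr)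
  simp only [zero_add, ftc] at this
  rw [z1 r le_rfl, zero_smul, intervalIntegral.integral_add] at this
  · rw [eq_neg_iff_add_eq_zero, add_comm]; exact this.symm
  · exact (hg r hr).continuousOn_smul hφ.continuous.continuousOn
  · exact (hd.intervalIntegrable _ _).smul_continuousOn
      (intervalIntegral.continuousOn_primitive_interval' (hg r hr) (by simp))

theorem aux_const_of_weak {X : Type*} [NormedAddCommGroup X] [NormedSpace ℝ X] [CompleteSpace X]
    {s : Set ℝ} (hs : InitSeg s) {h : ℝ → X} (hh : LocallyIntegrableOn h s)
    (hw : ∀ φ : ℝ → ℝ, ContDiff ℝ (⊤ : ℕ∞) φ → HasCompactSupport φ → tsupport φ ⊆ s →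
      (∫ t in s, deriv φ t • h t) = 0) :
    ∃ c : X, ∀ᵐ t ∂(volume.restrict s), h t = c := by
  obtain ⟨x0, hx0⟩ := hs.ne
  obtain ⟨ε, hε, hb⟩ := Metric.mem_nhds_iff.1 (hs.op.mem_nhds hx0)
  let bmp : ContDiffBump x0 := ⟨ε / 4, ε / 2, by linarith, by linarith⟩
  set ψ0 : ℝ → ℝ := bmp.normed volume with hψ0
  have d0 : ContDiff ℝ (⊤ : ℕ∞) ψ0 := bmp.contDiff_normed
  have c0 : HasCompactSupport ψ0 := bmp.hasCompactSupport_normed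
  have s0 : tsupport ψ0 ⊆ s := by
    rw [hψ0, bmp.tsupport_normed_eq]
    exact (Metric.closedBall_subset_ball (by show ε / 2 < ε; linarith)).trans hb
  have int0 : ∫ x, ψ0 x = 1 := bmp.integral_normed
  set c : X := ∫ t in s, ψ0 t • h t with hc
  refine ⟨c, ?_⟩
  have Iψ : ∀ ψ : ℝ → ℝ, ContDiff ℝ (⊤ : ℕ∞) ψ → HasCompactSupport ψ → tsupport ψ ⊆ s →
      ∀ h : ℝ → X, LocallyIntegrableOn h s → Integrable (fun t => ψ t • h t) := by
    intro ψ hψ hψc hψs h hh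
    have : IntegrableOn h (tsupport ψ) := hh.integrableOn_compact_subset hψs hψc
    have h2 : IntegrableOn (fun t => ψ t • h t) (tsupport ψ) :=
      this.continuousOn_smul hψ.continuous.continuousOn hψc
    refine (integrableOn_iff_integrable_of_support_subset ?_).1 h2
    intro x hx
    apply subset_tsupport
    intro hz
    exact hx (by simp [hz])
  have hcl : LocallyIntegrableOn (fun _ : ℝ => c) s := (locallyIntegrable_const c).locallyIntegrableOn s
  have key := hs.op.ae_eq_zero_of_integral_contDiff_smul_eq_zero (f := fun t => h t - c) (μ := volume)
    (hh.sub hcl) ?_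
  · refine (ae_restrict_iff' hs.mS).2 ?_
    filter_upwards [key] with x hx hxs
    exact sub_eq_zero.1 (hx hxs)
  intro ψ hψ hψc hψs
  set m := ∫ x, ψ x with hm
  set η : ℝ → ℝ := fun x => ψ x - m * ψ0 x with hη
  have dη : ContDiff ℝ (⊤ : ℕ∞) η := hψ.sub (contDiff_const.mul d0)
  set φ : ℝ → ℝ := fun x => ∫ y in (0:ℝ)..x, η y with hφ
  have hφd : ∀ x, HasDerivAt φ (η x) x := fun x =>
    intervalIntegral.integral_hasDerivAt_right (dη.continuous.intervalIntegrable _ _)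
      (dη.continuous.stronglyMeasurableAtFilter _ _) dη.continuous.continuousAt
  have hder : deriv φ = η := funext fun x => (hφd x).deriv
  have dφ : ContDiff ℝ (⊤ : ℕ∞) φ := by
    rw [contDiff_infty_iff_deriv]
    exact ⟨fun x => (hφd x).differentiableAt, by rw [hder]; exact dη⟩
  have hKc : IsCompact (tsupport ψ ∪ tsupport ψ0) := hψc.isCompact.union c0.isCompact
  have hη0 : ∀ x, x ∉ tsupport ψ ∪ tsupport ψ0 → η x = 0 := by
    intro x hx
    rw [mem_union, not_or] at hx
    simp [hη, image_eq_zero_of_notMem_tsupport hx.1, image_eq_zero_of_notMem_tsupport hx.2]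
  obtain ⟨r, hr, hbig⟩ := aux_beyond hs hKc (union_subset hψs s0)
  have hr0 : 0 < r := hs.pos hr
  obtain ⟨a, ha0, hsm⟩ : ∃ a > 0, ∀ x ∈ tsupport ψ ∪ tsupport ψ0, a < x := by
    rcases (tsupport ψ ∪ tsupport ψ0).eq_empty_or_nonempty with he | hne
    · exact ⟨1, one_pos, by simp [he]⟩
    · obtain ⟨m, hm, hmin⟩ := hKc.exists_isLeast hne
      have : 0 < m := hs.pos ((union_subset hψs s0) hm)
      exact ⟨m / 2, by linarith, fun x hx => by have := hmin hx; linarith⟩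
  have iψ : Integrable ψ := hψ.continuous.integrable_of_hasCompactSupport hψc
  have i0 : Integrable ψ0 := d0.continuous.integrable_of_hasCompactSupport c0
  have hηtot : ∫ x, η x = 0 := by
    simp only [hη]
    rw [integral_sub iψ (i0.const_mul m), integral_const_mul, int0, ← hm]; ring
  have φlow : ∀ x, x ≤ a → φ x = 0 := by
    intro x hx
    simp only [hφ]
    rw [intervalIntegral.integral_congr (g := fun _ => (0:ℝ))]
    · simp
    · intro y hy
      apply hη0
      intro hy2
      have h1 := hsm y hy2
      rw [mem_uIcc] at hy
      rcases hy with hy | hy <;> linarith [hy.1, hy.2]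
  have φhigh : ∀ x, r ≤ x → φ x = 0 := by
    intro x hx
    simp only [hφ]
    rw [intervalIntegral.integral_of_le (hr0.le.trans hx)]
    refine Eq.trans ?_ hηtot
    apply setIntegral_eq_integral_of_forall_compl_eq_zero
    intro y hy
    apply hη0
    intro hy2
    exact hy ⟨ha0.trans (hsm y hy2), (hbig y hy2).le.trans hx⟩
  have φsup : tsupport φ ⊆ Icc a r := by
    apply closure_minimal _ isClosed_Icc
    intro x hx
    constructor
    · by_contra hh; exact hx (φlow x (not_le.1 hh).le)
    · by_contra hh; exact hx (φhigh x (not_le.1 hh).le)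
  have φs : tsupport φ ⊆ s := φsup.trans fun x hx => hs.seg r hr ⟨ha0.trans_le hx.1, hx.2⟩
  have φc : HasCompactSupport φ := isCompact_Icc.of_isClosed_subset (isClosed_tsupport _) φsup
  have H := hw φ dφ φc φs
  rw [hder] at H
  simp only [hη, sub_smul, mul_smul] at H
  have I1 := Iψ ψ hψ hψc hψs h hh
  have I2 := Iψ ψ0 d0 c0 s0 h hh
  have I3 : IntegrableOn (fun t => m • ψ0 t • h t) s := (I2.smul m).integrableOn
  rw [integral_sub I1.integrableOn I3] at H
  rw [integral_smul, ← hc] at H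
  have e1 : ∫ t in s, ψ t • h t = ∫ t, ψ t • h t := by
    apply setIntegral_eq_integral_of_forall_compl_eq_zero
    intro x hx
    rw [image_eq_zero_of_notMem_tsupport (fun hh => hx (hψs hh)), zero_smul]
  simp only [smul_sub]
  rw [integral_sub I1 (Iψ ψ hψ hψc hψs _ hcl), integral_smul_const, ← hm, ← e1]
  exact H

theorem aux_holder (p α t : ℝ) (hp : 1 < p) (hα : α < 1 - 1 / p) (ht : 0 < t) :
    ∃ K : ENNReal, K ≠ ⊤ ∧ ∀ (X : Type*) [NormedAddCommGroup X] [NormedSpace ℝ X] (f : ℝ → X),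
      MemLp (fun r => r ^ α • f r) (ENNReal.ofReal p) (volume.restrict (Ioc 0 t)) →
      eLpNorm f 1 (volume.restrict (Ioc 0 t)) ≤
        K * eLpNorm (fun r => r ^ α • f r) (ENNReal.ofReal p) (volume.restrict (Ioc 0 t)) := by
  have hp0 : 0 < p := by linarith
  set q := p / (p - 1) with hq
  have hpq : p.HolderConjugate q := (Real.HolderConjugate.conjExponent hp)
  have hq0 : 0 < q := hpq.symm.pos
  have hp1 : 0 < p - 1 := by linarith
  have hαq : 0 < 1 - α * q := by
    have : α < (p - 1) / p := by rw [sub_div, div_self hp0.ne']; exact hα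
    have : α * q < 1 := by
      rw [hq, ← mul_div_assoc, div_lt_one hp1]
      exact (lt_div_iff₀ hp0).1 this
    linarith
  have hm : Measurable fun r : ℝ => r ^ (-α) := by fun_prop
  have hK : MemLp (fun r : ℝ => r ^ (-α)) (ENNReal.ofReal q) (volume.restrict (Ioc 0 t)) := by
    rw [← integrable_norm_rpow_iff hm.aestronglyMeasurable (by simpa using hq0) (by simp),
      ENNReal.toReal_ofReal hq0.le]
    have := (intervalIntegral.intervalIntegrable_rpow' (r := -α * q) (by linarith) (a := 0) (b := t)).1
    refine this.congr_fun ?_ measurableSet_Ioc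
    intro r hr
    have hr0 : 0 < r := hr.1
    simp only [Real.norm_eq_abs]
    rw [abs_of_pos (by positivity), ← Real.rpow_mul hr0.le]
  refine ⟨_, hK.2.ne, ?_⟩
  intro X _ _ f hf
  have : ENNReal.HolderTriple (ENNReal.ofReal q) (ENNReal.ofReal p) 1 := by
    have := hpq.symm.ennrealOfReal
    exact this
  have := eLpNorm_smul_le_mul_eLpNorm (p := ENNReal.ofReal q) (q := ENNReal.ofReal p) (r := 1)
    hf.1 hm.aestronglyMeasurable
  refine le_trans (le_of_eq ?_) this
  apply eLpNorm_congr_ae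
  refine (ae_restrict_iff' measurableSet_Ioc).2 (.of_forall fun r hr => ?_)
  have hr0 : 0 < r := hr.1
  simp only [Pi.smul_apply', ← mul_smul, ← Real.rpow_add hr0]
  simp

theorem aux_unweight_meas {X : Type*} [NormedAddCommGroup X] [NormedSpace ℝ X] {α : ℝ} {s : Set ℝ}
    (hs : MeasurableSet s) (hs0 : s ⊆ Ioi 0) {f : ℝ → X}
    (h : AEStronglyMeasurable (fun t => t ^ α • f t) (volume.restrict s)) :
    AEStronglyMeasurable f (volume.restrict s) := by
  have hm' : Measurable fun t : ℝ => t ^ (-α) := by fun_prop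
  refine (hm'.aestronglyMeasurable.smul h).congr ?_
  refine (ae_restrict_iff' hs).2 (.of_forall fun t ht => ?_)
  have : 0 < t := hs0 ht
  simp only [Pi.smul_apply', ← mul_smul, ← Real.rpow_add this]
  simp

theorem aux_intble {X : Type*} [NormedAddCommGroup X] [NormedSpace ℝ X] (p α : ℝ) (hp : 1 < p)
    (hα : α < 1 - 1 / p) {s : Set ℝ} (hs : InitSeg s) {f : ℝ → X}
    (hf : MemLp (fun r => r ^ α • f r) (ENNReal.ofReal p) (volume.restrict s)) :
    ∀ t ∈ s, IntervalIntegrable f volume 0 t := by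
  intro t ht
  have ht0 : 0 < t := hs.pos ht
  rw [intervalIntegrable_iff_integrableOn_Ioc_of_le ht0.le]
  obtain ⟨K, hK, h⟩ := aux_holder p α t hp hα ht0
  have hf' : MemLp (fun r => r ^ α • f r) (ENNReal.ofReal p) (volume.restrict (Ioc 0 t)) :=
    hf.mono_measure (Measure.restrict_mono (hs.seg t ht) le_rfl)
  rw [IntegrableOn, ← memLp_one_iff_integrable]
  refine ⟨aux_unweight_meas measurableSet_Ioc (fun r hr => hr.1) hf'.1, (h X f hf').trans_lt ?_⟩
  exact ENNReal.mul_lt_top hK.lt_top hf'.2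

/-- The same on the whole finite interval. -/
theorem aux_intble' {X : Type*} [NormedAddCommGroup X] [NormedSpace ℝ X] (p α : ℝ) (hp : 1 < p)
    (hα : α < 1 - 1 / p) {T : ℝ} (hT : 0 < T) {f : ℝ → X}
    (hf : MemLp (fun r => r ^ α • f r) (ENNReal.ofReal p) (volume.restrict (Ioo 0 T))) :
    IntervalIntegrable f volume 0 T := by
  rw [intervalIntegrable_iff_integrableOn_Ioc_of_le hT.le]
  obtain ⟨K, hK, h⟩ := aux_holder p α T hp hα hT
  have hf' : MemLp (fun r => r ^ α • f r) (ENNReal.ofReal p) (volume.restrict (Ioc 0 T)) := by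
    rwa [← Measure.restrict_congr_set Ioo_ae_eq_Ioc]
  rw [IntegrableOn, ← memLp_one_iff_integrable]
  refine ⟨aux_unweight_meas measurableSet_Ioc (fun r hr => hr.1) hf'.1, (h X f hf').trans_lt ?_⟩
  exact ENNReal.mul_lt_top hK.lt_top hf'.2


/-- integrated formulation -/
def ISol (s : Set ℝ) (ι A : X₁ →L[ℂ] X₀) (f : ℝ → X₀) (u : ℝ → X₁) : Prop :=
  ∀ᵐ t ∂(volume.restrict s), ι (u t) = ∫ r in (0:ℝ)..t, (f r - A (u r))

theorem aux_clm_memLp {α : ℝ} {q : ENNReal} {m : Measure ℝ} (A : X₁ →L[ℂ] X₀) {u : ℝ → X₁}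
    (hu : MemLp (fun t => t ^ α • u t) q m) : MemLp (fun t => t ^ α • A (u t)) q m := by
  have := A.comp_memLp' hu
  refine this.congr_norm ?_ ?_
  · convert this.1 using 2 with t
    simp
  · refine .of_forall fun t => ?_
    simp

theorem aux_intseg_congr {X : Type*} [NormedAddCommGroup X] [NormedSpace ℝ X] {s : Set ℝ}
    (hs : InitSeg s) {f g : ℝ → X} (h : ∀ᵐ t ∂(volume.restrict s), f t = g t) {t : ℝ} (ht : t ∈ s) :
    ∫ r in (0:ℝ)..t, f r = ∫ r in (0:ℝ)..t, g r := by
  rw [intervalIntegral.integral_of_le (hs.pos ht).le, intervalIntegral.integral_of_le (hs.pos ht).le]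
  exact integral_congr_ae (ae_restrict_of_ae_restrict_of_subset (hs.seg t ht) h)

theorem aux_to_ISol (p μ : ℝ) (hp : 1 < p) (hμ : 1 / p < μ) {s : Set ℝ} (hs : InitSeg s)
    {ι A : X₁ →L[ℂ] X₀} {f : ℝ → X₀} {u : ℝ → X₁} {u' : ℝ → X₀}
    (h : IsLinSol p μ s ι A f 0 u u') : ISol s ι A f u := by
  obtain ⟨⟨hu, -, hu', hl1, hl2, hw⟩, heq, w, wc, wae, w0⟩ := h
  rw [aux_memW_iff p μ hp s hs.mS hs.pos] at hu'
  have hint := aux_intble p (1 - μ) hp (by linarith) hs hu'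
  set U : ℝ → X₀ := fun t => ∫ r in (0:ℝ)..t, u' r with hU
  have hUc : ContinuousOn U (insert 0 s) := aux_contOn_prim hs hint
  have hUl : LocallyIntegrableOn U s :=
    (hUc.mono (subset_insert _ _)).locallyIntegrableOn hs.mS
  obtain ⟨c, hc⟩ := aux_const_of_weak hs (h := fun t => ι (u t) - U t) (hl1.sub hUl) (by
    intro φ h1 h2 h3
    have e1 := hw φ h1 h2 h3
    have e2 := aux_weak_of_int hs hint φ h1 h2 h3
    have hd : Continuous (deriv φ) := h1.continuous_deriv (by simp)
    have I : ∀ h : ℝ → X₀, LocallyIntegrableOn h s → IntegrableOn (fun t => deriv φ t • h t) s := by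
      intro h hh
      have : IntegrableOn h (tsupport φ) := hh.integrableOn_compact_subset h3 h2
      have h4 : IntegrableOn (fun t => deriv φ t • h t) (tsupport φ) :=
        this.continuousOn_smul hd.continuousOn h2
      refine ((integrableOn_iff_integrable_of_support_subset ?_).1 h4).integrableOn
      intro x hx
      apply support_deriv_subset
      intro hz
      exact hx (by simp [hz])
    simp only [smul_sub]
    rw [integral_sub (I _ hl1) (I _ hUl), e1, e2, sub_self])
  -- the constant is zero
  have hcw : ∀ᵐ t ∂(volume.restrict s), w t - U t = c := by
    filter_upwards [hc, wae] with t h1 h2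
    rw [h2]; exact h1
  have c0 : c = 0 := by
    have hcont : ContinuousWithinAt (fun t => w t - U t) s 0 :=
      ((wc.sub hUc) 0 (mem_insert _ _)).mono (subset_insert _ _)
    have h00 : w 0 - U 0 = 0 := by simp [w0, hU]
    by_contra hne
    have hev : ∀ᶠ t in nhdsWithin 0 s, w t - U t ≠ c := by
      apply hcont.eventually_ne
      show w 0 - U 0 ≠ c
      rw [h00]; exact fun h => hne h.symm
    rw [eventually_nhdsWithin_iff, Metric.eventually_nhds_iff] at hev
    obtain ⟨ε, hε, hev⟩ := hev
    obtain ⟨r, hr⟩ := hs.ne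
    have hr0 : 0 < r := hs.pos hr
    have hsub : Ioo 0 (min ε r) ⊆ s := fun t ht =>
      hs.seg r hr ⟨ht.1, (ht.2.trans_le (min_le_right _ _)).le⟩
    have hae := ae_restrict_of_ae_restrict_of_subset hsub hcw
    rw [ae_restrict_iff' measurableSet_Ioo] at hae
    have : volume (Ioo 0 (min ε r)) = 0 := by
      refine measure_mono_null ?_ hae
      intro t ht hh
      have h5 : |t| < ε := by rw [abs_of_pos ht.1]; exact ht.2.trans_le (min_le_left _ _)
      exact hev (by simpa [Real.dist_eq] using h5) (hsub ht) (hh ht)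
    simp at this
    rcases this with h | h <;> linarith
  unfold ISol
  rw [ae_restrict_iff' hs.mS] at hc ⊢
  filter_upwards [hc] with t ht hts
  have := ht hts
  rw [c0, sub_eq_zero] at this
  rw [this]
  apply aux_intseg_congr hs _ hts
  filter_upwards [heq] with r hr
  rw [← hr]; abel

theorem aux_of_ISol (p μ : ℝ) (hp : 1 < p) (hμ : 1 / p < μ) {s : Set ℝ} (hs : InitSeg s)
    {ι A : X₁ →L[ℂ] X₀} {f : ℝ → X₀} {u : ℝ → X₁}
    (hf : MemLp (fun t => t ^ (1 - μ) • f t) (ENNReal.ofReal p) (volume.restrict s))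
    (hu : MemLp (fun t => t ^ (1 - μ) • u t) (ENNReal.ofReal p) (volume.restrict s))
    (h : ISol s ι A f u) : IsLinSol p μ s ι A f 0 u (fun t => f t - A (u t)) := by
  have hg : MemLp (fun t => t ^ (1 - μ) • (f t - A (u t))) (ENNReal.ofReal p)
      (volume.restrict s) := by
    simp only [smul_sub]
    exact hf.sub (aux_clm_memLp A hu)
  have hint := aux_intble p (1 - μ) hp (by linarith) hs hg
  have hιu := aux_clm_memLp ι hu
  have hint' := aux_intble p (1 - μ) hp (by linarith) hs hιu
  refine ⟨⟨(aux_memW_iff p μ hp s hs.mS hs.pos _).2 hu, (aux_memW_iff p μ hp s hs.mS hs.pos _).2 hιu,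
    (aux_memW_iff p μ hp s hs.mS hs.pos _).2 hg, aux_locInt hs hint', aux_locInt hs hint, ?_⟩,
    .of_forall fun t => by simp, ?_⟩
  · intro φ h1 h2 h3
    rw [← aux_weak_of_int hs hint φ h1 h2 h3]
    apply integral_congr_ae
    filter_upwards [h] with t ht
    rw [ht]
  · refine ⟨fun t => ∫ r in (0:ℝ)..t, (f r - A (u r)), aux_contOn_prim hs hint, ?_, by simp⟩
    filter_upwards [h] with t ht
    exact ht.symm

theorem aux_intble0 {X : Type*} [NormedAddCommGroup X] [NormedSpace ℝ X] (p : ℝ) (hp : 1 < p)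
    {s : Set ℝ} (hs : InitSeg s) {f : ℝ → X}
    (hf : MemLp f (ENNReal.ofReal p) (volume.restrict s)) :
    ∀ t ∈ s, IntervalIntegrable f volume 0 t := by
  refine aux_intble p 0 hp ?_ hs (by simpa using hf)
  have : 1 / p < 1 := by rw [div_lt_one (by linarith)]; exact hp
  linarith


theorem aux_clm_norm {q : ENNReal} {m : Measure ℝ} {α : ℝ} (A : X₁ →L[ℂ] X₀) (u : ℝ → X₁) :
    eLpNorm (fun t => t ^ α • A (u t)) q m ≤ ‖A‖ₑ * eLpNorm (fun t => t ^ α • u t) q m := by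
  have := eLpNorm_le_nnreal_smul_eLpNorm_of_ae_le_mul (μ := m)
    (f := fun t => t ^ α • A (u t)) (g := fun t => t ^ α • u t) (c := ‖A‖₊)
    (.of_forall fun t => by
      have e : t ^ α • A (u t) = A (t ^ α • u t) := by simp
      show ‖t ^ α • A (u t)‖₊ ≤ _
      rw [e]
      exact A.le_opNNNorm _) q
  exact this

theorem ISol.congr {s : Set ℝ} (hs : InitSeg s) {ι A : X₁ →L[ℂ] X₀} {f f' : ℝ → X₀}
    {u u' : ℝ → X₁} (h : ISol s ι A f u) (hf : ∀ᵐ t ∂(volume.restrict s), f t = f' t)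
    (hu : ∀ᵐ t ∂(volume.restrict s), u t = u' t) : ISol s ι A f' u' := by
  unfold ISol at *
  filter_upwards [h, hu, ae_restrict_mem hs.mS] with t h1 h2 ht
  rw [← h2, h1]
  apply aux_intseg_congr hs _ ht
  filter_upwards [hf, hu] with r h3 h4
  rw [h3, h4]

theorem ISol.lin {s : Set ℝ} (hs : InitSeg s) {ι A : X₁ →L[ℂ] X₀} {f f' : ℝ → X₀}
    {u u' : ℝ → X₁} (c : ℂ) (h : ISol s ι A f u) (h' : ISol s ι A f' u')
    (if1 : ∀ t ∈ s, IntervalIntegrable f volume 0 t) (if2 : ∀ t ∈ s, IntervalIntegrable f' volume 0 t)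
    (iu1 : ∀ t ∈ s, IntervalIntegrable u volume 0 t) (iu2 : ∀ t ∈ s, IntervalIntegrable u' volume 0 t) :
    ISol s ι A (fun t => f t + c • f' t) (fun t => u t + c • u' t) := by
  unfold ISol at *
  have cl : ∀ v : ℝ → X₁, (∀ t ∈ s, IntervalIntegrable v volume 0 t) →
      ∀ t ∈ s, IntervalIntegrable (fun r => A (v r)) volume 0 t := by
    intro v hv t ht
    exact ⟨A.integrable_comp (hv t ht).1, A.integrable_comp (hv t ht).2⟩
  filter_upwards [h, h', ae_restrict_mem hs.mS] with t h1 h2 ht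
  rw [map_add, map_smul, h1, h2, ← intervalIntegral.integral_smul, ← intervalIntegral.integral_add]
  · congr 1; ext r
    simp only [map_add, map_smul, smul_sub]; abel
  · exact (if1 t ht).sub (cl u iu1 t ht)
  · exact ((if2 t ht).sub (cl u' iu2 t ht)).smul c

theorem aux_closed (p α : ℝ) (hp : 1 < p) (hα : α < 1 - 1 / p) {s : Set ℝ} (hs : InitSeg s)
    {ι A : X₁ →L[ℂ] X₀} {F : ℕ → ℝ → X₀} {U : ℕ → ℝ → X₁} {f : ℝ → X₀} {u : ℝ → X₁}
    (hF : ∀ n, MemLp (fun t => t ^ α • F n t) (ENNReal.ofReal p) (volume.restrict s))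
    (hU : ∀ n, MemLp (fun t => t ^ α • U n t) (ENNReal.ofReal p) (volume.restrict s))
    (hf : MemLp (fun t => t ^ α • f t) (ENNReal.ofReal p) (volume.restrict s))
    (hu : MemLp (fun t => t ^ α • u t) (ENNReal.ofReal p) (volume.restrict s))
    (cF : Filter.Tendsto (fun n => eLpNorm (fun t => t ^ α • (F n t - f t)) (ENNReal.ofReal p)
      (volume.restrict s)) Filter.atTop (nhds 0))
    (cU : Filter.Tendsto (fun n => eLpNorm (fun t => t ^ α • (U n t - u t)) (ENNReal.ofReal p)
      (volume.restrict s)) Filter.atTop (nhds 0))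
    (hsol : ∀ n, ISol s ι A (F n) (U n)) : ISol s ι A f u := by
  have hp0 : 0 < p := by linarith
  have hone : (1:ENNReal) ≤ ENNReal.ofReal p := by simpa using hp.le
  have tm := tendstoInMeasure_of_tendsto_eLpNorm (μ := volume.restrict s) (p := ENNReal.ofReal p)
    (f := fun n t => t ^ α • U n t) (g := fun t => t ^ α • u t) (l := Filter.atTop)
    (by simpa using hp0) (fun n => (hU n).1) hu.1 (by
      refine cU.congr fun n => ?_
      congr 1; ext t; simp [smul_sub])
  obtain ⟨ns, hns, hae⟩ := tm.exists_seq_tendsto_ae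
  have hall := ae_all_iff.2 hsol
  unfold ISol
  filter_upwards [hae, hall, ae_restrict_mem hs.mS] with t h1 h2 ht
  have ht0 : 0 < t := hs.pos ht
  have l1 : Filter.Tendsto (fun n => ι (U (ns n) t)) Filter.atTop (nhds (ι (u t))) := by
    have := (h1.const_smul (t ^ (-α)))
    simp only [← mul_smul, ← Real.rpow_add ht0] at this
    simp only [neg_add_cancel, Real.rpow_zero, one_smul] at this
    exact (ι.continuous.tendsto _).comp this
  have hG : ∀ n, MemLp (fun t => t ^ α • (F n t - A (U n t))) (ENNReal.ofReal p)
      (volume.restrict s) := fun n => by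
    simp only [smul_sub]
    exact (hF n).sub (aux_clm_memLp A (hU n))
  have hg : MemLp (fun t => t ^ α • (f t - A (u t))) (ENNReal.ofReal p)
      (volume.restrict s) := by
    simp only [smul_sub]
    exact hf.sub (aux_clm_memLp A hu)
  have l2 : Filter.Tendsto (fun n => ∫ r in (0:ℝ)..t, (F n r - A (U n r))) Filter.atTop
      (nhds (∫ r in (0:ℝ)..t, (f r - A (u r)))) := by
    simp only [intervalIntegral.integral_of_le ht0.le]
    apply tendsto_integral_of_L1' _ (aux_intble p α hp hα hs hg t ht).1.aestronglyMeasurable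
    · exact .of_forall fun n => (aux_intble p α hp hα hs (hG n) t ht).1
    · obtain ⟨K, hK, hH⟩ := aux_holder p α t hp hα ht0
      have hb : Filter.Tendsto (fun n => K * (eLpNorm (fun t => t ^ α • (F n t - f t))
          (ENNReal.ofReal p) (volume.restrict s) + ‖A‖ₑ * eLpNorm (fun t => t ^ α • (U n t - u t))
            (ENNReal.ofReal p) (volume.restrict s))) Filter.atTop (nhds 0) := by
        have := ENNReal.Tendsto.const_mul (a := K) (cF.add (ENNReal.Tendsto.const_mul (a := ‖A‖ₑ) cU
          (Or.inr enorm_ne_top))) (Or.inr hK)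
        simpa using this
      refine tendsto_of_tendsto_of_tendsto_of_le_of_le tendsto_const_nhds hb (fun _ => zero_le) ?_
      intro n
      have hd : MemLp (fun t => t ^ α • ((F n t - A (U n t)) - (f t - A (u t)))) (ENNReal.ofReal p)
          (volume.restrict s) := by
        have := (hG n).sub hg
        convert this using 1
        ext t; simp [smul_sub]
      have hd' := hd.mono_measure (Measure.restrict_mono (hs.seg t ht) le_rfl)
      refine (hH X₀ _ hd').trans ?_
      refine mul_le_mul' le_rfl ?_
      refine (eLpNorm_mono_measure _ (Measure.restrict_mono (hs.seg t ht) le_rfl)).trans ?_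
      have e : (fun t => t ^ α • ((F n t - A (U n t)) - (f t - A (u t)))) =
          (fun t => t ^ α • (F n t - f t)) - fun t => t ^ α • A (U n t - u t) := by
        ext t; simp [smul_sub]; abel
      have hUu : MemLp (fun t => t ^ α • (U n t - u t)) (ENNReal.ofReal p) (volume.restrict s) := by
        simp only [smul_sub]; exact (hU n).sub hu
      have hFf : MemLp (fun t => t ^ α • (F n t - f t)) (ENNReal.ofReal p) (volume.restrict s) := by
        simp only [smul_sub]; exact (hF n).sub hf
      rw [e]
      refine (eLpNorm_sub_le hFf.1 (aux_clm_memLp A hUu).1 hone).trans ?_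
      gcongr
      exact aux_clm_norm A _
  refine tendsto_nhds_unique l1 ((l2.comp hns.tendsto_atTop).congr fun n => ?_)
  exact (h2 (ns n)).symm

theorem aux_bound (p : ℝ) (hp : 1 < p) (ι A : X₁ →L[ℂ] X₀)
    (hE : ∀ f : ℝ → X₀, MemLp f (ENNReal.ofReal p) (volume.restrict (Ioi 0)) →
      ∃ u : ℝ → X₁, MemLp u (ENNReal.ofReal p) (volume.restrict (Ioi 0)) ∧ ISol (Ioi 0) ι A f u)
    (hU : ∀ u : ℝ → X₁, MemLp u (ENNReal.ofReal p) (volume.restrict (Ioi 0)) →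
      ISol (Ioi 0) ι A 0 u → ∀ᵐ t ∂(volume.restrict (Ioi 0)), u t = 0) :
    ∃ C : ENNReal, C ≠ ⊤ ∧ ∀ (f : ℝ → X₀) (u : ℝ → X₁),
      MemLp f (ENNReal.ofReal p) (volume.restrict (Ioi 0)) →
      MemLp u (ENNReal.ofReal p) (volume.restrict (Ioi 0)) → ISol (Ioi 0) ι A f u →
      eLpNorm u (ENNReal.ofReal p) (volume.restrict (Ioi 0)) ≤
        C * eLpNorm f (ENNReal.ofReal p) (volume.restrict (Ioi 0)) := by
  have hα : (0:ℝ) < 1 - 1 / p := by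
    have : 1 / p < 1 := by rw [div_lt_one (by linarith)]; exact hp
    linarith
  have hone : (1:ENNReal) ≤ ENNReal.ofReal p := by simpa using hp.le
  set q := ENNReal.ofReal p with hq
  set m : Measure ℝ := volume.restrict (Ioi 0) with hm
  have : Fact (1 ≤ q) := ⟨hone⟩
  have int0 : ∀ f : Lp X₀ q m, ∀ t ∈ Ioi (0:ℝ), IntervalIntegrable f volume 0 t := fun f =>
    aux_intble0 p hp initSeg_Ioi (Lp.memLp f)
  have int1 : ∀ f : Lp X₁ q m, ∀ t ∈ Ioi (0:ℝ), IntervalIntegrable f volume 0 t := fun f =>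
    aux_intble0 p hp initSeg_Ioi (Lp.memLp f)
  have zero : ISol (Ioi 0) ι A (0 : ℝ → X₀) (0 : ℝ → X₁) := by
    refine .of_forall fun t => ?_
    simp
  have lin : ∀ (c : ℂ) (x y : Lp X₀ q m × Lp X₁ q m), ISol (Ioi 0) ι A x.1 x.2 →
      ISol (Ioi 0) ι A y.1 y.2 → ISol (Ioi 0) ι A (x + c • y).1 (x + c • y).2 := by
    intro c x y hx hy
    refine (ISol.lin initSeg_Ioi c hx hy (int0 _) (int0 _) (int1 _) (int1 _)).congr initSeg_Ioi ?_ ?_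
    · have h1 := Lp.coeFn_add x.1 (c • y.1)
      have h2 := Lp.coeFn_smul c y.1
      filter_upwards [h1, h2] with t h1 h2
      simp only [Prod.fst_add, Prod.smul_fst, h1, Pi.add_apply, h2, Pi.smul_apply]
    · have h1 := Lp.coeFn_add x.2 (c • y.2)
      have h2 := Lp.coeFn_smul c y.2
      filter_upwards [h1, h2] with t h1 h2
      simp only [Prod.snd_add, Prod.smul_snd, h1, Pi.add_apply, h2, Pi.smul_apply]
  have zero' : ISol (Ioi 0) ι A (0 : Lp X₀ q m × Lp X₁ q m).1 (0 : Lp X₀ q m × Lp X₁ q m).2 := by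
    refine zero.congr initSeg_Ioi ?_ ?_
    · filter_upwards [Lp.coeFn_zero X₀ q m] with t ht
      exact ht.symm
    · filter_upwards [Lp.coeFn_zero X₁ q m] with t ht
      exact ht.symm
  let G : Submodule ℂ (Lp X₀ q m × Lp X₁ q m) :=
    { carrier := {x | ISol (Ioi 0) ι A x.1 x.2}
      add_mem' := fun {x y} hx hy => by simpa using lin 1 x y hx hy
      zero_mem' := zero'
      smul_mem' := fun c x hx => by
        have := lin c 0 x zero' hx
        rwa [zero_add] at this }
  have hGc : IsClosed (G : Set (Lp X₀ q m × Lp X₁ q m)) := by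
    apply IsSeqClosed.isClosed
    intro x y hx hxy
    have c1 := (Lp.tendsto_Lp_iff_tendsto_eLpNorm' _ _).1 ((continuous_fst.tendsto y).comp hxy)
    have c2 := (Lp.tendsto_Lp_iff_tendsto_eLpNorm' _ _).1 ((continuous_snd.tendsto y).comp hxy)
    exact aux_closed p 0 hp hα initSeg_Ioi (F := fun n => (x n).1) (U := fun n => (x n).2)
      (fun n => by simpa using Lp.memLp (x n).1) (fun n => by simpa using Lp.memLp (x n).2)
      (by simpa using Lp.memLp y.1) (by simpa using Lp.memLp y.2)
      (by simp only [Real.rpow_zero, one_smul]; exact c1)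
      (by simp only [Real.rpow_zero, one_smul]; exact c2) (fun n => hx n)
  have : CompleteSpace G := hGc.completeSpace_coe
  let π : G →L[ℂ] Lp X₀ q m := (ContinuousLinearMap.fst ℂ _ _).comp G.subtypeL
  have hker : π.ker = ⊥ := by
    rw [LinearMap.ker_eq_bot']
    rintro ⟨⟨a, b⟩, hx⟩ h0
    have ha : a = 0 := h0
    subst ha
    have hb : ISol (Ioi 0) ι A (0 : ℝ → X₀) b := by
      refine ISol.congr initSeg_Ioi (show ISol (Ioi 0) ι A (0 : Lp X₀ q m) b from hx) ?_
        (.of_forall fun _ => rfl)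
      filter_upwards [Lp.coeFn_zero X₀ q m] with t ht
      exact ht
    have := hU b (Lp.memLp b) hb
    have hb0 : b = 0 := by
      apply Lp.ext
      filter_upwards [this, Lp.coeFn_zero X₁ q m] with t h1 h2
      rw [h1, h2]; rfl
    subst hb0
    rfl
  have hran : π.range = ⊤ := by
    rw [LinearMap.range_eq_top]
    intro f
    obtain ⟨u, hu, hs⟩ := hE f (Lp.memLp f)
    refine ⟨⟨(f, hu.toLp u), ?_⟩, rfl⟩
    refine ISol.congr initSeg_Ioi hs (.of_forall fun _ => rfl) ?_
    filter_upwards [hu.coeFn_toLp] with t ht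
    exact ht.symm
  let e := ContinuousLinearEquiv.ofBijective π hker hran
  let L : Lp X₀ q m →L[ℂ] Lp X₁ q m :=
    ((ContinuousLinearMap.snd ℂ _ _).comp G.subtypeL).comp (e.symm : Lp X₀ q m →L[ℂ] G)
  refine ⟨‖L‖ₑ, enorm_ne_top, fun f u hf hu hs => ?_⟩
  have hmem : (hf.toLp f, hu.toLp u) ∈ G := by
    refine ISol.congr initSeg_Ioi hs ?_ ?_
    · filter_upwards [hf.coeFn_toLp] with t ht
      exact ht.symm
    · filter_upwards [hu.coeFn_toLp] with t ht
      exact ht.symm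
  have hL : L (hf.toLp f) = hu.toLp u := by
    have : e.symm (hf.toLp f) = ⟨_, hmem⟩ := by
      rw [ContinuousLinearEquiv.symm_apply_eq]
      rfl
    show (e.symm (hf.toLp f) : Lp X₀ q m × Lp X₁ q m).2 = _
    rw [this]
  rw [← Lp.enorm_toLp hf, ← Lp.enorm_toLp hu, ← hL]
  exact L.le_opENorm _

theorem aux_shift {ι A : X₁ →L[ℂ] X₀} {a : ℝ} (ha : 0 ≤ a) {g : ℝ → X₀} {v : ℝ → X₁}
    (hg : ∀ t ≤ a, g t = 0) (h : ISol (Ioi 0) ι A (fun t => g (t + a)) v) :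
    ISol (Ioi 0) ι A g (fun t => (Ioi 0).indicator v (t - a)) := by
  unfold ISol at *
  rw [ae_restrict_iff' measurableSet_Ioi] at *
  have h' := (measurePreserving_sub_right volume a).quasiMeasurePreserving.ae h
  filter_upwards [h'] with t h1 ht
  have e0 : ∫ r in (0:ℝ)..t, (g r - A ((Ioi 0).indicator v (r - a))) =
      ∫ r in (-a)..(t - a), (Ioi 0).indicator (fun r => g (r + a) - A (v r)) r := by
    have := intervalIntegral.integral_comp_sub_right (a := 0) (b := t)
      (fun r => (Ioi 0).indicator (fun r => g (r + a) - A (v r)) r) a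
    rw [zero_sub] at this
    rw [← this]
    congr 1; ext r
    by_cases hr : r - a ∈ Ioi (0:ℝ)
    · simp only [indicator_of_mem hr, sub_add_cancel]
    · rw [indicator_of_notMem hr, indicator_of_notMem hr, hg r (by simpa using hr)]; simp
  rw [e0, intervalIntegral.integral_of_le (by have : 0 < t := ht; linarith),
    setIntegral_indicator measurableSet_Ioi]
  by_cases hr : t - a ∈ Ioi (0:ℝ)
  · rw [indicator_of_mem hr, h1 hr, intervalIntegral.integral_of_le (le_of_lt hr)]
    congr 2
    ext r
    simp only [mem_Ioc, mem_inter_iff, mem_Ioi]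
    constructor
    · rintro ⟨h1, h2⟩; exact ⟨⟨by linarith, h2⟩, h1⟩
    · rintro ⟨⟨h1, h2⟩, h3⟩; exact ⟨h3, h2⟩
  · have : Ioc (-a) (t - a) ∩ Ioi 0 = ∅ := by
      ext r
      simp only [mem_Ioc, mem_inter_iff, mem_Ioi, mem_empty_iff_false, iff_false] at *
      rintro ⟨⟨h1, h2⟩, h3⟩; linarith
    rw [this, indicator_of_notMem hr]; simp

theorem aux_loc (p : ℝ) (hp : 1 < p) {ι A : X₁ →L[ℂ] X₀}
    (hE : ∀ f : ℝ → X₀, MemLp f (ENNReal.ofReal p) (volume.restrict (Ioi 0)) →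
      ∃ u : ℝ → X₁, MemLp u (ENNReal.ofReal p) (volume.restrict (Ioi 0)) ∧ ISol (Ioi 0) ι A f u)
    (hU : ∀ u : ℝ → X₁, MemLp u (ENNReal.ofReal p) (volume.restrict (Ioi 0)) →
      ISol (Ioi 0) ι A 0 u → ∀ᵐ t ∂(volume.restrict (Ioi 0)), u t = 0)
    {T' T : ℝ} (hT' : 0 < T') (hTT : T' < T) {d : ℝ → X₁}
    (hd : MemLp d (ENNReal.ofReal p) (volume.restrict (Ioo 0 T))) (hs : ISol (Ioo 0 T) ι A 0 d) :
    ∀ᵐ t ∂(volume.restrict (Ioo 0 T')), d t = 0 := by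
  have hT : 0 < T := hT'.trans hTT
  set D := (Ioo 0 T).indicator d with hD
  have hDm : MemLp D (ENNReal.ofReal p) volume := (memLp_indicator_iff_restrict measurableSet_Ioo).2 hd
  have hDi := aux_intble0 p hp initSeg_Ioi (hDm.restrict (Ioi 0))
  set k : ℝ → X₀ := fun r => -A (D r) with hk
  have hki : ∀ t ∈ Ioi (0:ℝ), IntervalIntegrable k volume 0 t := fun t ht =>
    IntervalIntegrable.neg ⟨A.integrable_comp (hDi t ht).1, A.integrable_comp (hDi t ht).2⟩
  set h : ℝ → ℝ := (Ioo T' T).indicator (fun _ => -(T - T')⁻¹) with hh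
  have hhm : Measurable h := measurable_const.indicator measurableSet_Ioo
  have hhi : Integrable h := by
    rw [hh, integrable_indicator_iff measurableSet_Ioo]
    exact integrableOn_const (by simp)
  set Φ : ℝ → ℝ := fun t => 1 + ∫ s in (0:ℝ)..t, h s with hΦ
  have hΦc : Continuous Φ := continuous_const.add
    (intervalIntegral.continuous_primitive (fun a b => hhi.intervalIntegrable) 0)
  have hΦ1 : ∀ t, 0 ≤ t → t ≤ T' → Φ t = 1 := by
    intro t h0 h1
    rw [hΦ]
    simp only [hh]
    rw [intervalIntegral.integral_of_le h0, setIntegral_indicator measurableSet_Ioo]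
    have : Ioc 0 t ∩ Ioo T' T = ∅ := by
      ext r
      simp only [mem_Ioc, mem_inter_iff, mem_Ioo, mem_empty_iff_false, iff_false]
      rintro ⟨⟨h1, h2⟩, h3, h4⟩; linarith
    rw [this]; simp
  have hΦ0 : ∀ t, T ≤ t → Φ t = 0 := by
    intro t h0
    rw [hΦ]
    simp only [hh]
    rw [intervalIntegral.integral_of_le (by linarith), setIntegral_indicator measurableSet_Ioo]
    have : Ioc 0 t ∩ Ioo T' T = Ioo T' T := by
      ext r
      simp only [mem_Ioc, mem_inter_iff, mem_Ioo, and_iff_right_iff_imp]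
      rintro ⟨h3, h4⟩; constructor <;> linarith
    have h2 : T - T' ≠ 0 := by linarith
    rw [this, setIntegral_const, measureReal_def, Real.volume_Ioo,
      ENNReal.toReal_ofReal (by linarith)]
    simp [h2]
  obtain ⟨M, hM⟩ := (isCompact_Icc (a := (0:ℝ)) (b := T)).exists_bound_of_continuousOn hΦc.continuousOn
  set W : ℝ → X₁ := fun t => Φ t • D t with hW
  have hWm : MemLp W (ENNReal.ofReal p) volume := by
    refine hDm.of_le_mul (c := M) (hΦc.aestronglyMeasurable.smul hDm.1) (.of_forall fun t => ?_)
    by_cases ht : t ∈ Ioo 0 T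
    · rw [hW]; simp only [norm_smul]
      gcongr
      exact hM t ⟨ht.1.le, ht.2.le⟩
    · have : D t = 0 := indicator_of_notMem ht _
      simp [hW, this]
  set U : ℝ → X₀ := fun t => ∫ r in (0:ℝ)..t, k r with hUd
  have hUD : ∀ᵐ t, t ∈ Ioo 0 T → U t = ι (D t) := by
    rw [← ae_restrict_iff' measurableSet_Ioo]
    unfold ISol at hs
    filter_upwards [hs, ae_restrict_mem measurableSet_Ioo] with t h1 ht
    have e : D t = d t := indicator_of_mem ht _
    rw [e, h1]
    apply aux_intseg_congr (initSeg_Ioo T hT) _ ht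
    filter_upwards [ae_restrict_mem measurableSet_Ioo] with r hr
    have e : D r = d r := indicator_of_mem hr _
    simp [hk, e]
  set g : ℝ → X₀ := fun t => h t • ι (D t) with hg
  have hgm : MemLp g (ENNReal.ofReal p) volume := by
    refine (ι.comp_memLp' hDm).of_le_mul (c := (T - T')⁻¹)
      (hhm.aestronglyMeasurable.smul (ι.comp_memLp' hDm).1) (.of_forall fun t => ?_)
    have hpos : 0 < (T - T')⁻¹ := by rw [inv_pos]; linarith
    rw [hg]; simp only [norm_smul]
    refine mul_le_mul_of_nonneg_right ?_ (norm_nonneg _)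
    by_cases ht : t ∈ Ioo T' T
    · rw [hh, indicator_of_mem ht, norm_neg, Real.norm_of_nonneg hpos.le]
    · rw [hh, indicator_of_notMem ht]; simpa using hpos.le
  have hWs : ISol (Ioi 0) ι A g W := by
    unfold ISol
    rw [ae_restrict_iff' measurableSet_Ioi]
    filter_upwards [hUD] with t h1 ht
    have ht0 : 0 < t := ht
    have e1 : ι (W t) = Φ t • U t := by
      by_cases h2 : t < T
      · rw [h1 ⟨ht, h2⟩]; simp [hW]
      · simp [hW, hΦ0 t (not_lt.1 h2)]
    rw [e1, hΦ, hUd]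
    simp only
    rw [aux_prod_int h k 1 t ht0.le (hhi.intervalIntegrable) (hki t ht)]
    rw [intervalIntegral.integral_of_le ht0.le, intervalIntegral.integral_of_le ht0.le]
    apply integral_congr_ae
    rw [Filter.EventuallyEq, ae_restrict_iff' measurableSet_Ioc]
    filter_upwards [hUD] with s h3 hs
    have e2 : h s • U s = g s := by
      by_cases h2 : s < T
      · rw [h3 ⟨hs.1, h2⟩]
      · have : h s = 0 := indicator_of_notMem (fun h' => h2 h'.2) _
        simp [hg, this]
    have e3 : Φ s • k s = - A (W s) := by simp [hk, hW]
    show Φ s • k s + h s • U s = _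
    rw [e2, e3]; abel
  have hg0 : ∀ t ≤ T', g t = 0 := by
    intro t ht
    have : h t = 0 := indicator_of_notMem (fun h' => absurd h'.1 (not_lt.2 ht)) _
    simp [hg, this]
  have hgsm : MemLp (fun t => g (t + T')) (ENNReal.ofReal p) volume :=
    hgm.comp_measurePreserving (measurePreserving_add_right volume T')
  obtain ⟨v, hv, hvs⟩ := hE _ (hgsm.restrict _)
  have hVs := aux_shift hT'.le hg0 hvs
  set V : ℝ → X₁ := fun t => (Ioi 0).indicator v (t - T') with hV
  have hVm : MemLp V (ENNReal.ofReal p) volume :=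
    ((memLp_indicator_iff_restrict measurableSet_Ioi).2 hv).comp_measurePreserving
      (measurePreserving_sub_right volume T')
  have hgi := aux_intble0 p hp initSeg_Ioi (hgm.restrict (Ioi 0))
  have hlin := ISol.lin initSeg_Ioi (-1) hWs hVs hgi hgi
    (aux_intble0 p hp initSeg_Ioi (hWm.restrict (Ioi 0)))
    (aux_intble0 p hp initSeg_Ioi (hVm.restrict (Ioi 0)))
  have hz := hU (fun t => W t + (-1:ℂ) • V t) ((hWm.add (hVm.const_smul (-1:ℂ))).restrict _)
    (hlin.congr initSeg_Ioi (.of_forall fun t => by simp) (.of_forall fun t => rfl))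
  filter_upwards [ae_restrict_of_ae_restrict_of_subset (s := Ioo 0 T') (fun x hx => hx.1) hz,
    ae_restrict_mem measurableSet_Ioo] with t h1 ht
  have e1 : V t = 0 := indicator_of_notMem (by simpa using ht.2.le) _
  have e2 : D t = d t := indicator_of_mem (show t ∈ Ioo 0 T from ⟨ht.1, ht.2.trans hTT⟩) _
  rw [e1, hW] at h1
  simpa [hΦ1 t ht.1.le ht.2.le, e2] using h1

theorem aux_loc' (p : ℝ) (hp : 1 < p) {ι A : X₁ →L[ℂ] X₀}
    (hE : ∀ f : ℝ → X₀, MemLp f (ENNReal.ofReal p) (volume.restrict (Ioi 0)) →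
      ∃ u : ℝ → X₁, MemLp u (ENNReal.ofReal p) (volume.restrict (Ioi 0)) ∧ ISol (Ioi 0) ι A f u)
    (hU : ∀ u : ℝ → X₁, MemLp u (ENNReal.ofReal p) (volume.restrict (Ioi 0)) →
      ISol (Ioi 0) ι A 0 u → ∀ᵐ t ∂(volume.restrict (Ioi 0)), u t = 0)
    {T : ℝ} (hT : 0 < T) {d : ℝ → X₁}
    (hd : MemLp d (ENNReal.ofReal p) (volume.restrict (Ioo 0 T))) (hs : ISol (Ioo 0 T) ι A 0 d) :
    ∀ᵐ t ∂(volume.restrict (Ioo 0 T)), d t = 0 := by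
  have h : ∀ n : ℕ, ∀ᵐ t ∂(volume.restrict (Ioo 0 (T - T / (n + 2)))), d t = 0 := by
    intro n
    have h2 : (0:ℝ) < n + 2 := by positivity
    refine aux_loc p hp hE hU ?_ ?_ hd hs
    · rw [sub_pos, div_lt_iff₀ h2]
      nlinarith [(Nat.cast_nonneg n : (0:ℝ) ≤ n)]
    · have : 0 < T / (n + 2) := by positivity
      linarith
  rw [← ae_restrict_iUnion_iff] at h
  refine ae_restrict_of_ae_restrict_of_subset ?_ h
  intro t ht
  obtain ⟨n, hn⟩ := exists_nat_gt (T / (T - t))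
  have h3 : 0 < T - t := by linarith [ht.2]
  refine mem_iUnion.2 ⟨n, ht.1, ?_⟩
  rw [div_lt_iff₀ h3] at hn
  have h2 : (0:ℝ) < n + 2 := by positivity
  have : T / (n + 2) < T - t := by
    rw [div_lt_iff₀ h2]; nlinarith
  linarith

theorem ISol.restr {s : Set ℝ} {T : ℝ} (hT : 0 < T) (hsub : Ioo 0 T ⊆ s)
    {ι A : X₁ →L[ℂ] X₀} {f f' : ℝ → X₀} {u : ℝ → X₁} (h : ISol s ι A f u)
    (hf : ∀ t ∈ Ioo 0 T, f t = f' t) : ISol (Ioo 0 T) ι A f' u := by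
  have h1 : ISol (Ioo 0 T) ι A f u := ae_restrict_of_ae_restrict_of_subset hsub h
  exact h1.congr (initSeg_Ioo T hT) ((ae_restrict_iff' measurableSet_Ioo).2 (.of_forall hf))
    (.of_forall fun _ => rfl)

theorem aux_fin (p : ℝ) (hp : 1 < p) {ι A : X₁ →L[ℂ] X₀}
    (hE : ∀ f : ℝ → X₀, MemLp f (ENNReal.ofReal p) (volume.restrict (Ioi 0)) →
      ∃ u : ℝ → X₁, MemLp u (ENNReal.ofReal p) (volume.restrict (Ioi 0)) ∧ ISol (Ioi 0) ι A f u)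
    (hU : ∀ u : ℝ → X₁, MemLp u (ENNReal.ofReal p) (volume.restrict (Ioi 0)) →
      ISol (Ioi 0) ι A 0 u → ∀ᵐ t ∂(volume.restrict (Ioi 0)), u t = 0) :
    ∃ C : ENNReal, C ≠ ⊤ ∧ ∀ T : ℝ, 0 < T →
      (∀ f : ℝ → X₀, MemLp f (ENNReal.ofReal p) (volume.restrict (Ioo 0 T)) →
        ∃ u : ℝ → X₁, MemLp u (ENNReal.ofReal p) (volume.restrict (Ioo 0 T)) ∧
          ISol (Ioo 0 T) ι A f u) ∧
      ∀ (f : ℝ → X₀) (u : ℝ → X₁),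
      MemLp f (ENNReal.ofReal p) (volume.restrict (Ioo 0 T)) →
      MemLp u (ENNReal.ofReal p) (volume.restrict (Ioo 0 T)) → ISol (Ioo 0 T) ι A f u →
      eLpNorm u (ENNReal.ofReal p) (volume.restrict (Ioo 0 T)) ≤
        C * eLpNorm f (ENNReal.ofReal p) (volume.restrict (Ioo 0 T)) := by
  obtain ⟨C, hC, hb⟩ := aux_bound p hp ι A hE hU
  refine ⟨C, hC, fun T hT => ?_⟩
  have hsub : Ioo 0 T ⊆ Ioi 0 := fun x hx => hx.1
  have key : ∀ f : ℝ → X₀, MemLp f (ENNReal.ofReal p) (volume.restrict (Ioo 0 T)) →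
        ∃ u : ℝ → X₁, MemLp u (ENNReal.ofReal p) (volume.restrict (Ioo 0 T)) ∧
          ISol (Ioo 0 T) ι A f u ∧ eLpNorm u (ENNReal.ofReal p) (volume.restrict (Ioo 0 T)) ≤
        C * eLpNorm f (ENNReal.ofReal p) (volume.restrict (Ioo 0 T)) := by
    intro f hf
    have hf' : MemLp ((Ioo 0 T).indicator f) (ENNReal.ofReal p) (volume.restrict (Ioi 0)) :=
      ((memLp_indicator_iff_restrict measurableSet_Ioo).2 hf).restrict _
    obtain ⟨u, hu, hs⟩ := hE _ hf'
    refine ⟨u, hu.mono_measure (Measure.restrict_mono hsub le_rfl),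
      hs.restr hT hsub (fun t ht => indicator_of_mem ht _), ?_⟩
    refine (eLpNorm_mono_measure _ (Measure.restrict_mono hsub le_rfl)).trans ?_
    refine (hb _ _ hf' hu hs).trans (le_of_eq ?_)
    rw [eLpNorm_indicator_eq_eLpNorm_restrict measurableSet_Ioo,
      Measure.restrict_restrict measurableSet_Ioo, inter_eq_left.2 hsub]
  refine ⟨fun f hf => ?_, fun f u hf hu hs => ?_⟩
  · obtain ⟨u, h1, h2, -⟩ := key f hf
    exact ⟨u, h1, h2⟩
  · obtain ⟨v, h1, h2, h3⟩ := key f hf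
    have i := initSeg_Ioo T hT
    have hlin := ISol.lin i (-1) hs h2 (aux_intble0 p hp i hf) (aux_intble0 p hp i hf)
      (aux_intble0 p hp i hu) (aux_intble0 p hp i h1)
    have hz := aux_loc' p hp hE hU hT (d := fun t => u t + (-1:ℂ) • v t)
      (hu.add (h1.const_smul (-1:ℂ)))
      (hlin.congr i (.of_forall fun t => by simp) (.of_forall fun t => rfl))
    rw [eLpNorm_congr_ae (g := v)]
    · exact h3
    · filter_upwards [hz] with t ht
      have : u t - v t = 0 := by simpa [sub_eq_add_neg] using ht
      exact sub_eq_zero.1 this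

theorem aux_pow {X : Type*} [NormedAddCommGroup X] (p : ℝ) (hp : 1 < p) (m : Measure ℝ) (g : ℝ → X) :
    eLpNorm g (ENNReal.ofReal p) m ^ p = ∫⁻ t, ‖g t‖ₑ ^ p ∂m := by
  have hp0 : 0 < p := by linarith
  rw [eLpNorm_eq_lintegral_rpow_enorm_toReal (by simpa using hp0) (by simp),
    ENNReal.toReal_ofReal hp0.le, ← ENNReal.rpow_mul, one_div_mul_cancel hp0.ne', ENNReal.rpow_one]

theorem aux_wpow {X : Type*} [NormedAddCommGroup X] [NormedSpace ℝ X] (p β T : ℝ) (hp : 1 < p)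
    (g : ℝ → X) :
    ∫⁻ t in Ioi (0:ℝ), ENNReal.ofReal (t ^ (β * p)) * (Ioo 0 T).indicator (fun t => ‖g t‖ₑ ^ p) t =
    eLpNorm (fun t => t ^ β • g t) (ENNReal.ofReal p) (volume.restrict (Ioo 0 T)) ^ p := by
  have hp0 : 0 < p := by linarith
  rw [aux_pow p hp]
  have e : (fun t : ℝ => ENNReal.ofReal (t ^ (β * p)) * (Ioo 0 T).indicator (fun t => ‖g t‖ₑ ^ p) t)
      = (Ioo 0 T).indicator (fun t => ENNReal.ofReal (t ^ (β * p)) * ‖g t‖ₑ ^ p) := by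
    ext t
    by_cases ht : t ∈ Ioo 0 T
    · simp only [indicator_of_mem ht]
    · simp only [indicator_of_notMem ht, mul_zero]
  rw [e, lintegral_indicator measurableSet_Ioo, Measure.restrict_restrict measurableSet_Ioo,
    inter_eq_left.2 (fun x hx => hx.1)]
  apply setLIntegral_congr_fun measurableSet_Ioo
  intro t ht
  have ht0 : 0 < t := ht.1
  simp only [enorm_smul]
  rw [ENNReal.mul_rpow_of_nonneg _ _ hp0.le, Real.rpow_mul ht0.le,
    Real.enorm_of_nonneg (by positivity), ENNReal.ofReal_rpow_of_nonneg (by positivity) hp0.le]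

theorem aux_root {p : ℝ} (hp : 1 < p) {a b K : ENNReal} (h : a ^ p ≤ K * b ^ p) :
    a ≤ K ^ (1 / p) * b := by
  have hp0 : 0 < p := by linarith
  have h1 := ENNReal.rpow_le_rpow h (z := 1 / p) (by positivity)
  rwa [ENNReal.mul_rpow_of_nonneg _ _ (by positivity), ← ENNReal.rpow_mul, ← ENNReal.rpow_mul,
    mul_one_div_cancel hp0.ne', ENNReal.rpow_one, ENNReal.rpow_one] at h1

theorem aux_cont_memLp {X : Type*} [NormedAddCommGroup X] {q : ENNReal} {T : ℝ} {F : ℝ → X}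
    (hF : ContinuousOn F (Icc 0 T)) : MemLp F q (volume.restrict (Ioo 0 T)) := by
  obtain ⟨M, hM⟩ := isCompact_Icc.exists_bound_of_continuousOn hF
  refine MemLp.of_bound ((hF.mono Ioo_subset_Icc_self).aestronglyMeasurable measurableSet_Ioo) M ?_
  filter_upwards [ae_restrict_mem measurableSet_Ioo] with t ht
  exact hM t (Ioo_subset_Icc_self ht)


/-- uniform a priori bound on finite intervals -/
def FinB (p : ℝ) (ι A : X₁ →L[ℂ] X₀) (C : ENNReal) : Prop :=
  ∀ T : ℝ, 0 < T → ∀ (f : ℝ → X₀) (u : ℝ → X₁),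
      MemLp f (ENNReal.ofReal p) (volume.restrict (Ioo 0 T)) →
      MemLp u (ENNReal.ofReal p) (volume.restrict (Ioo 0 T)) → ISol (Ioo 0 T) ι A f u →
      eLpNorm u (ENNReal.ofReal p) (volume.restrict (Ioo 0 T)) ≤
        C * eLpNorm f (ENNReal.ofReal p) (volume.restrict (Ioo 0 T))

theorem aux_stepA (p α : ℝ) (hp : 1 < p) (hα : α < 1 - 1 / p)
    {ι A : X₁ →L[ℂ] X₀} {C : ENNReal} (hC : C ≠ ⊤) (hb : FinB p ι A C) :
    ∃ K : ENNReal, K ≠ ⊤ ∧ ∀ T : ℝ, 0 < T → ∀ (f : ℝ → X₀) (u : ℝ → X₁),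
      MemLp (fun t => t ^ α • f t) (ENNReal.ofReal p) (volume.restrict (Ioo 0 T)) →
      MemLp (fun t => t ^ α • u t) (ENNReal.ofReal p) (volume.restrict (Ioo 0 T)) →
      ISol (Ioo 0 T) ι A f u →
      eLpNorm (fun t => t ^ (α - 1) • ι (u t)) (ENNReal.ofReal p) (volume.restrict (Ioo 0 T)) ≤
        K * eLpNorm (fun t => t ^ α • f t) (ENNReal.ofReal p) (volume.restrict (Ioo 0 T)) := by
  have hp0 : 0 < p := by linarith
  have hone : (1:ENNReal) ≤ ENNReal.ofReal p := by simpa using hp.le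
  have hα1 : α < 1 := by
    have : 0 < 1 / p := by positivity
    linarith
  obtain ⟨K, hK, hH⟩ := aux_hardy p α hp hα
  set K1 : ENNReal := 1 + ‖A‖ₑ * C with hK1
  have hK1t : K1 ≠ ⊤ := ENNReal.add_ne_top.2 ⟨by simp, ENNReal.mul_ne_top enorm_ne_top hC⟩
  refine ⟨(K1 ^ p * K) ^ (1 / p), ?_, ?_⟩
  · exact ENNReal.rpow_ne_top_of_nonneg (by positivity)
      (ENNReal.mul_ne_top (ENNReal.rpow_ne_top_of_nonneg hp0.le hK1t) hK)
  intro T hT f u hf hu hs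
  have iT := initSeg_Ioo T hT
  have fi := aux_intble' p α hp hα hT hf
  have ui := aux_intble' p α hp hα hT hu
  have fit := aux_intble p α hp hα iT hf
  have uit := aux_intble p α hp hα iT hu
  set w : ℝ → X₁ := fun t => ∫ r in (0:ℝ)..t, u r with hw
  set F : ℝ → X₀ := fun t => ∫ r in (0:ℝ)..t, f r with hF
  have wc : ContinuousOn w (Icc 0 T) := by
    have := intervalIntegral.continuousOn_primitive_interval' ui (a := 0) (by simp)
    rwa [uIcc_of_le hT.le] at this
  have Fc : ContinuousOn F (Icc 0 T) := by
    have := intervalIntegral.continuousOn_primitive_interval' fi (a := 0) (by simp)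
    rwa [uIcc_of_le hT.le] at this
  have e1 : ∀ᵐ t ∂(volume.restrict (Ioo 0 T)), ι (u t) = F t - A (w t) := by
    unfold ISol at hs
    filter_upwards [hs, ae_restrict_mem measurableSet_Ioo] with t h1 ht
    rw [h1, intervalIntegral.integral_sub (fit t ht), A.intervalIntegral_comp_comm (uit t ht)]
    exact ⟨A.integrable_comp (uit t ht).1, A.integrable_comp (uit t ht).2⟩
  have hws : ISol (Ioo 0 T) ι A F w := by
    unfold ISol
    filter_upwards [ae_restrict_mem measurableSet_Ioo] with t ht
    rw [hw]
    simp only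
    rw [← ι.intervalIntegral_comp_comm (uit t ht)]
    exact aux_intseg_congr iT e1 ht
  have key : ∀ s, 0 < s → s ≤ T → ∫⁻ t in Ioo 0 s, ‖ι (u t)‖ₑ ^ p ≤
      K1 ^ p * ∫⁻ t in Ioo 0 s, ‖F t‖ₑ ^ p := by
    intro s hs0 hsT
    have hsub : Ioo 0 s ⊆ Ioo 0 T := Ioo_subset_Ioo le_rfl hsT
    have hsub' : Icc 0 s ⊆ Icc 0 T := Icc_subset_Icc le_rfl hsT
    have Fm : MemLp F (ENNReal.ofReal p) (volume.restrict (Ioo 0 s)) := aux_cont_memLp (Fc.mono hsub')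
    have wm : MemLp w (ENNReal.ofReal p) (volume.restrict (Ioo 0 s)) := aux_cont_memLp (wc.mono hsub')
    have b1 := hb s hs0 F w Fm wm (hws.restr hs0 hsub (fun _ _ => rfl))
    have b2 : eLpNorm (fun t => A (w t)) (ENNReal.ofReal p) (volume.restrict (Ioo 0 s)) ≤
        ‖A‖ₑ * eLpNorm w (ENNReal.ofReal p) (volume.restrict (Ioo 0 s)) := by
      simpa using aux_clm_norm (α := 0) (m := volume.restrict (Ioo 0 s)) (q := ENNReal.ofReal p) A w
    rw [← aux_pow p hp, ← aux_pow p hp, ← ENNReal.mul_rpow_of_nonneg _ _ hp0.le]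
    refine ENNReal.rpow_le_rpow ?_ hp0.le
    rw [eLpNorm_congr_ae (ae_restrict_of_ae_restrict_of_subset hsub e1)]
    refine (eLpNorm_sub_le Fm.1 (A.comp_memLp' wm).1 hone).trans ?_
    calc _ ≤ eLpNorm F (ENNReal.ofReal p) (volume.restrict (Ioo 0 s)) +
          ‖A‖ₑ * (C * eLpNorm F (ENNReal.ofReal p) (volume.restrict (Ioo 0 s))) :=
            add_le_add le_rfl (b2.trans (mul_le_mul' le_rfl b1))
      _ = _ := by rw [hK1]; ring
  have um : AEStronglyMeasurable u (volume.restrict (Ioo 0 T)) :=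
    aux_unweight_meas measurableSet_Ioo (fun x hx => hx.1) hu.1
  have fm : AEStronglyMeasurable f (volume.restrict (Ioo 0 T)) :=
    aux_unweight_meas measurableSet_Ioo (fun x hx => hx.1) hf.1
  have mI : ∀ g : ℝ → X₀, AEStronglyMeasurable g (volume.restrict (Ioo 0 T)) →
      AEMeasurable ((Ioo 0 T).indicator fun t => ‖g t‖ₑ ^ p) := by
    intro g hg
    rw [aemeasurable_indicator_iff measurableSet_Ioo]
    exact hg.enorm.pow_const p
  have decr := aux_decr ((1 - α) * p) (by nlinarith) ((Ioo 0 T).indicator fun t => ‖ι (u t)‖ₑ ^ p)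
    ((Ioo 0 T).indicator fun t => ‖F t‖ₑ ^ p)
    (mI _ (ι.continuous.comp_aestronglyMeasurable um))
    (mI _ ((Fc.mono Ioo_subset_Icc_self).aestronglyMeasurable measurableSet_Ioo))
    (K1 ^ p) (ENNReal.rpow_ne_top_of_nonneg hp0.le hK1t) (by
      intro s hs0
      rw [lintegral_indicator measurableSet_Ioo, lintegral_indicator measurableSet_Ioo,
        Measure.restrict_restrict measurableSet_Ioo, Ioo_inter_Ioo]
      have := key (min T s) (lt_min hT hs0) (min_le_left _ _)
      simpa using this)
  have hardy := hH ((Ioo 0 T).indicator fun t => ‖f t‖ₑ) (by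
    rw [aemeasurable_indicator_iff measurableSet_Ioo]
    exact fm.enorm)
  have eq1 : -((1 - α) * p) = (α - 1) * p := by ring
  rw [eq1] at decr hardy
  rw [aux_wpow p (α - 1) T hp] at decr
  apply aux_root hp
  refine decr.trans ?_
  rw [mul_assoc]
  refine mul_le_mul' le_rfl ?_
  have e2 : ∀ t, ((Ioo 0 T).indicator (fun t => ‖f t‖ₑ) t) ^ p =
      (Ioo 0 T).indicator (fun t => ‖f t‖ₑ ^ p) t := by
    intro t
    by_cases ht : t ∈ Ioo 0 T
    · simp only [indicator_of_mem ht]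
    · simp only [indicator_of_notMem ht]; simp [hp0]
  simp only [e2] at hardy
  rw [aux_wpow p α T hp] at hardy
  refine le_trans ?_ hardy
  apply setLIntegral_mono' measurableSet_Ioi
  intro t ht
  refine mul_le_mul' le_rfl ?_
  by_cases htT : t ∈ Ioo 0 T
  · rw [indicator_of_mem htT]
    refine ENNReal.rpow_le_rpow ?_ hp0.le
    rw [hF]
    simp only
    rw [intervalIntegral.integral_of_le htT.1.le, integral_Ioc_eq_integral_Ioo]
    refine (enorm_integral_le_lintegral_enorm _).trans (le_of_eq ?_)
    apply setLIntegral_congr_fun measurableSet_Ioo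
    intro r hr
    simp only
    rw [indicator_of_mem (show r ∈ Ioo 0 T from ⟨hr.1, hr.2.trans htT.2⟩)]
  · rw [indicator_of_notMem htT]; exact zero_le

theorem aux_apriori (p α : ℝ) (hp : 1 < p) (hα0 : 0 ≤ α) (hα : α < 1 - 1 / p)
    {ι A : X₁ →L[ℂ] X₀} {C : ENNReal} (hC : C ≠ ⊤) (hb : FinB p ι A C) :
    ∃ K : ENNReal, K ≠ ⊤ ∧ ∀ T : ℝ, 0 < T → ∀ (f : ℝ → X₀) (u : ℝ → X₁),
      MemLp (fun t => t ^ α • f t) (ENNReal.ofReal p) (volume.restrict (Ioo 0 T)) →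
      MemLp (fun t => t ^ α • u t) (ENNReal.ofReal p) (volume.restrict (Ioo 0 T)) →
      ISol (Ioo 0 T) ι A f u →
      eLpNorm (fun t => t ^ α • u t) (ENNReal.ofReal p) (volume.restrict (Ioo 0 T)) ≤
        K * eLpNorm (fun t => t ^ α • f t) (ENNReal.ofReal p) (volume.restrict (Ioo 0 T)) := by
  have hp0 : 0 < p := by linarith
  have hone : (1:ENNReal) ≤ ENNReal.ofReal p := by simpa using hp.le
  rcases hα0.eq_or_lt with rfl | hα0
  · refine ⟨C, hC, fun T hT f u hf hu hs => ?_⟩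
    simp only [Real.rpow_zero, one_smul] at *
    exact hb T hT f u hf hu hs
  obtain ⟨K, hK, hA⟩ := aux_stepA p α hp hα hC hb
  refine ⟨C * (1 + ‖α‖ₑ * K), ENNReal.mul_ne_top hC (ENNReal.add_ne_top.2
    ⟨by simp, ENNReal.mul_ne_top enorm_ne_top hK⟩), fun T hT f u hf hu hs => ?_⟩
  have hA' := hA T hT f u hf hu hs
  have iT := initSeg_Ioo T hT
  have fit := aux_intble p α hp hα iT hf
  have uit := aux_intble p α hp hα iT hu
  have um : AEStronglyMeasurable u (volume.restrict (Ioo 0 T)) :=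
    aux_unweight_meas measurableSet_Ioo (fun x hx => hx.1) hu.1
  have mr : Measurable fun t : ℝ => t ^ (α - 1) := by fun_prop
  have m1 : MemLp (fun t => t ^ (α - 1) • ι (u t)) (ENNReal.ofReal p) (volume.restrict (Ioo 0 T)) :=
    ⟨mr.aestronglyMeasurable.smul (ι.continuous.comp_aestronglyMeasurable um),
      hA'.trans_lt (ENNReal.mul_lt_top hK.lt_top hf.2)⟩
  have m2 := m1.const_smul α
  have hprim : ∀ t : ℝ, 0 + ∫ r in (0:ℝ)..t, α * r ^ (α - 1) = t ^ α := by
    intro t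
    rw [intervalIntegral.integral_const_mul, integral_rpow (Or.inl (by linarith)), sub_add_cancel,
      Real.zero_rpow hα0.ne', sub_zero, zero_add, mul_div_cancel₀ _ hα0.ne']
  have hv : ISol (Ioo 0 T) ι A (fun t => t ^ α • f t + α • t ^ (α - 1) • ι (u t))
      (fun t => t ^ α • u t) := by
    unfold ISol at hs ⊢
    filter_upwards [hs, ae_restrict_mem measurableSet_Ioo] with t h1 ht
    have hg : IntervalIntegrable (fun r => f r - A (u r)) volume 0 t :=
      (fit t ht).sub ⟨A.integrable_comp (uit t ht).1, A.integrable_comp (uit t ht).2⟩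
    have hpr := aux_prod_int (fun r => α * r ^ (α - 1)) _ 0 t ht.1.le
      ((intervalIntegral.intervalIntegrable_rpow' (by linarith)).const_mul α) hg
    simp only [hprim] at hpr
    have e : ι (t ^ α • u t) = t ^ α • ι (u t) := by simp
    rw [e, h1, hpr]
    apply aux_intseg_congr iT _ ht
    filter_upwards [hs] with r h2
    rw [← h2]
    have e : A (r ^ α • u r) = r ^ α • A (u r) := by simp
    rw [e, smul_sub, mul_smul]; abel
  have := hb T hT _ _ (hf.add m2) hu hv
  refine this.trans ?_
  rw [mul_assoc]
  refine mul_le_mul' le_rfl ?_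
  refine (eLpNorm_add_le hf.1 m2.1 hone).trans ?_
  rw [add_mul, one_mul]
  refine add_le_add le_rfl ?_
  refine eLpNorm_const_smul_le.trans ?_
  rw [mul_assoc]
  exact mul_le_mul' le_rfl hA'

theorem aux_trunc {X : Type*} [NormedAddCommGroup X] [NormedSpace ℝ X] (p α : ℝ) (hp : 1 < p)
    {T : ℝ} {f : ℝ → X}
    (hf : MemLp (fun t => t ^ α • f t) (ENNReal.ofReal p) (volume.restrict (Ioo 0 T))) :
    Filter.Tendsto (fun n : ℕ => eLpNorm (fun t => t ^ α •
      ((Ioi (1 / ((n:ℝ) + 1))).indicator f t - f t)) (ENNReal.ofReal p)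
      (volume.restrict (Ioo 0 T))) Filter.atTop (nhds 0) := by
  have hp0 : 0 < p := by linarith
  have hfm : AEStronglyMeasurable f (volume.restrict (Ioo 0 T)) :=
    aux_unweight_meas measurableSet_Ioo (fun x hx => hx.1) hf.1
  have hm : Measurable fun t : ℝ => t ^ α := by fun_prop
  have hfin : ∫⁻ t in Ioo 0 T, ‖t ^ α • f t‖ₑ ^ p ≠ ⊤ := by
    rw [← aux_pow p hp]
    exact ENNReal.rpow_ne_top_of_nonneg hp0.le hf.2.ne
  have h := tendsto_lintegral_of_dominated_convergence' (μ := volume.restrict (Ioo 0 T))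
    (F := fun (n : ℕ) t => ‖t ^ α • ((Ioi (1 / ((n:ℝ) + 1))).indicator f t - f t)‖ₑ ^ p)
    (f := fun _ => 0) (fun t => ‖t ^ α • f t‖ₑ ^ p)
    (fun n => ((hm.aestronglyMeasurable.smul
      ((hfm.indicator measurableSet_Ioi).sub hfm)).enorm.pow_const p))
    (fun n => .of_forall fun t => by
      refine ENNReal.rpow_le_rpow ?_ hp0.le
      by_cases ht : t ∈ Ioi (1 / ((n:ℝ) + 1))
      · rw [indicator_of_mem ht]; simp
      · rw [indicator_of_notMem ht]; simp [enorm_smul])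
    hfin (by
      filter_upwards [ae_restrict_mem measurableSet_Ioo] with t ht
      apply tendsto_const_nhds.congr'
      have := tendsto_one_div_add_atTop_nhds_zero_nat (𝕜 := ℝ)
      filter_upwards [this.eventually (gt_mem_nhds ht.1)] with n hn
      rw [indicator_of_mem (show t ∈ Ioi (1 / ((n:ℝ) + 1)) from hn)]
      simp [hp0])
  simp only [← aux_pow p hp, lintegral_zero] at h
  have h2 := (ENNReal.continuous_rpow_const (y := 1 / p)).tendsto 0 |>.comp h
  rw [ENNReal.zero_rpow_of_pos (by positivity)] at h2
  refine h2.congr fun n => ?_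
  simp only [Function.comp]
  rw [← ENNReal.rpow_mul, mul_one_div_cancel hp0.ne', ENNReal.rpow_one]


theorem aux_exist (p α : ℝ) (hp : 1 < p) (hα0 : 0 ≤ α) (hα : α < 1 - 1 / p)
    {ι A : X₁ →L[ℂ] X₀} {K : ENNReal} (hK : K ≠ ⊤) {T : ℝ} (hT : 0 < T)
    (hex : ∀ f : ℝ → X₀, MemLp f (ENNReal.ofReal p) (volume.restrict (Ioo 0 T)) →
        ∃ u : ℝ → X₁, MemLp u (ENNReal.ofReal p) (volume.restrict (Ioo 0 T)) ∧
          ISol (Ioo 0 T) ι A f u)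
    (hb : ∀ (f : ℝ → X₀) (u : ℝ → X₁),
      MemLp (fun t => t ^ α • f t) (ENNReal.ofReal p) (volume.restrict (Ioo 0 T)) →
      MemLp (fun t => t ^ α • u t) (ENNReal.ofReal p) (volume.restrict (Ioo 0 T)) →
      ISol (Ioo 0 T) ι A f u →
      eLpNorm (fun t => t ^ α • u t) (ENNReal.ofReal p) (volume.restrict (Ioo 0 T)) ≤
        K * eLpNorm (fun t => t ^ α • f t) (ENNReal.ofReal p) (volume.restrict (Ioo 0 T)))
    {f : ℝ → X₀}
    (hf : MemLp (fun t => t ^ α • f t) (ENNReal.ofReal p) (volume.restrict (Ioo 0 T))) :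
    ∃ u : ℝ → X₁, MemLp (fun t => t ^ α • u t) (ENNReal.ofReal p) (volume.restrict (Ioo 0 T)) ∧
      ISol (Ioo 0 T) ι A f u := by
  have hp0 : 0 < p := by linarith
  have hone : (1:ENNReal) ≤ ENNReal.ofReal p := by simpa using hp.le
  have : Fact (1 ≤ ENNReal.ofReal p) := ⟨hone⟩
  have iT := initSeg_Ioo T hT
  have hm : Measurable fun t : ℝ => t ^ α := by fun_prop
  have hm' : Measurable fun t : ℝ => t ^ (-α) := by fun_prop
  have hfm : AEStronglyMeasurable f (volume.restrict (Ioo 0 T)) :=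
    aux_unweight_meas measurableSet_Ioo (fun x hx => hx.1) hf.1
  set F : ℕ → ℝ → X₀ := fun n => (Ioi (1 / ((n:ℝ) + 1))).indicator f with hF
  have hFm : ∀ n, MemLp (F n) (ENNReal.ofReal p) (volume.restrict (Ioo 0 T)) := by
    intro n
    refine hf.of_le_mul (c := ((1 / ((n:ℝ) + 1)) ^ α)⁻¹) (hfm.indicator measurableSet_Ioi)
      (.of_forall fun t => ?_)
    have hn : 0 < 1 / ((n:ℝ) + 1) := by positivity
    have hn' : 0 < (1 / ((n:ℝ) + 1)) ^ α := by positivity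
    by_cases ht : t ∈ Ioi (1 / ((n:ℝ) + 1))
    · have ht' : 1 / ((n:ℝ) + 1) < t := ht
      have ht0 : 0 < t := hn.trans ht'
      have h1 : (1 / ((n:ℝ) + 1)) ^ α ≤ t ^ α := Real.rpow_le_rpow hn.le ht'.le hα0
      rw [hF]
      simp only [indicator_of_mem ht]
      rw [norm_smul, Real.norm_of_nonneg (by positivity), ← mul_assoc, inv_mul_eq_div]
      exact le_mul_of_one_le_left (norm_nonneg _) ((one_le_div hn').2 h1)
    · rw [hF]
      simp only [indicator_of_notMem ht, norm_zero]
      positivity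
  have hFw : ∀ n, MemLp (fun t => t ^ α • F n t) (ENNReal.ofReal p) (volume.restrict (Ioo 0 T)) := by
    intro n
    refine hf.of_le (hm.aestronglyMeasurable.smul (hFm n).1) (.of_forall fun t => ?_)
    rw [norm_smul, norm_smul]
    exact mul_le_mul_of_nonneg_left (norm_indicator_le_norm_self _ _) (norm_nonneg _)
  choose U hUm hUs using fun n => hex (F n) (hFm n)
  have hUw : ∀ n, MemLp (fun t => t ^ α • U n t) (ENNReal.ofReal p) (volume.restrict (Ioo 0 T)) := by
    intro n
    refine (hUm n).of_le_mul (c := T ^ α) (hm.aestronglyMeasurable.smul (hUm n).1) ?_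
    filter_upwards [ae_restrict_mem measurableSet_Ioo] with t ht
    have ht0 : 0 < t := ht.1
    rw [norm_smul, Real.norm_of_nonneg (by positivity)]
    exact mul_le_mul_of_nonneg_right (Real.rpow_le_rpow ht0.le ht.2.le hα0) (norm_nonneg _)
  have cF := aux_trunc p α hp hf
  have cF' : Filter.Tendsto (fun n => (hFw n).toLp _) Filter.atTop (nhds (hf.toLp _)) := by
    rw [Lp.tendsto_Lp_iff_tendsto_eLpNorm'']
    refine cF.congr fun n => ?_
    congr 1; ext t; simp [hF, smul_sub]
  have hdist : ∀ m n, dist ((hUw m).toLp _) ((hUw n).toLp _) ≤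
      K.toReal * dist ((hFw m).toLp _) ((hFw n).toLp _) := by
    intro m n
    have hlin := ISol.lin iT (-1) (hUs m) (hUs n) (aux_intble0 p hp iT (hFm m))
      (aux_intble0 p hp iT (hFm n)) (aux_intble0 p hp iT (hUm m)) (aux_intble0 p hp iT (hUm n))
    have e0 : (fun t : ℝ => t ^ α • (F m t + (-1:ℂ) • F n t)) =
        (fun t => t ^ α • F m t) - fun t => t ^ α • F n t := by
      ext t; simp [smul_sub, sub_eq_add_neg]
    have e1 : (fun t : ℝ => t ^ α • (U m t + (-1:ℂ) • U n t)) =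
        (fun t => t ^ α • U m t) - fun t => t ^ α • U n t := by
      ext t; simp [smul_sub, sub_eq_add_neg]
    have h := hb _ _ (by rw [e0]; exact (hFw m).sub (hFw n)) (by rw [e1]; exact (hUw m).sub (hUw n)) hlin
    rw [e0, e1] at h
    rw [dist_eq_norm, dist_eq_norm, ← MemLp.toLp_sub, ← MemLp.toLp_sub, Lp.norm_toLp, Lp.norm_toLp,
      ← ENNReal.toReal_mul]
    exact ENNReal.toReal_mono (ENNReal.mul_ne_top hK ((hFw m).sub (hFw n)).2.ne) h
  have hcau : CauchySeq (fun n => (hUw n).toLp _) := by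
    have h1 := cF'.cauchySeq
    rw [Metric.cauchySeq_iff] at h1 ⊢
    intro ε hε
    have hK0 : 0 ≤ K.toReal := ENNReal.toReal_nonneg
    obtain ⟨N, hN⟩ := h1 (ε / (K.toReal + 1)) (by positivity)
    refine ⟨N, fun m hm n hn => (hdist m n).trans_lt ?_⟩
    have h2 := hN m hm n hn
    rw [lt_div_iff₀ (by positivity)] at h2
    nlinarith [dist_nonneg (x := (hFw m).toLp _) (y := (hFw n).toLp _)]
  obtain ⟨V, hV⟩ := cauchySeq_tendsto_of_complete hcau
  have hVw : ∀ᵐ t ∂(volume.restrict (Ioo 0 T)), V t = t ^ α • (t ^ (-α) • V t) := by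
    filter_upwards [ae_restrict_mem measurableSet_Ioo] with t ht
    rw [← mul_smul, ← Real.rpow_add ht.1]; simp
  have hum : MemLp (fun t => t ^ α • (t ^ (-α) • V t)) (ENNReal.ofReal p)
      (volume.restrict (Ioo 0 T)) := (memLp_congr_ae hVw).1 (Lp.memLp V)
  refine ⟨fun t => t ^ (-α) • V t, hum, ?_⟩
  refine aux_closed p α hp hα iT hFw hUw hf hum cF ?_ hUs
  rw [Lp.tendsto_Lp_iff_tendsto_eLpNorm'] at hV
  refine hV.congr fun n => ?_
  apply eLpNorm_congr_ae
  filter_upwards [hVw, (hUw n).coeFn_toLp] with t h1 h2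
  rw [smul_sub, ← h1, Pi.sub_apply, h2]

/-- **Maximal regularity on finite intervals with a uniform constant.** Let
`1 < p < ∞`, `μ ∈ (1/p,1]` and `A ∈ MR_p(X₀)`. Then there is `C > 0` such that for every
`T ∈ (0,∞)` and every `f ∈ L_{p,μ}((0,T);X₀)` there is a unique `u ∈ E_{1,μ}(0,T)` with
`u̇ + A u = f` a.e. on `(0,T)` and `u(0) = 0`, and it satisfies
`‖u‖_{E_{1,μ}(0,T)} ≤ C ‖f‖_{L_{p,μ}((0,T);X₀)}`, with `C` independent of `T` and `f`. -/
theorem statement9 (p μ : ℝ) (hp : 1 < p) (hμ : 1 / p < μ) (hμ1 : μ ≤ 1)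
    (ι A : X₁ →L[ℂ] X₀) (hinj : Function.Injective ι) (hdense : DenseRange ι)
    (hgraph : GraphNormEquiv ι A) (hMR : MRw p 1 ι A) :
    ∃ C > (0 : ℝ), ∀ T > (0 : ℝ), ∀ f : ℝ → X₀, MemWLp p μ (Set.Ioo 0 T) f →
      (∃ u u', IsLinSol p μ (Set.Ioo 0 T) ι A f 0 u u') ∧
      (∀ u₁ u₁' u₂ u₂', IsLinSol p μ (Set.Ioo 0 T) ι A f 0 u₁ u₁' →
        IsLinSol p μ (Set.Ioo 0 T) ι A f 0 u₂ u₂' →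
        ∀ᵐ t ∂(volume.restrict (Set.Ioo 0 T)), u₁ t = u₂ t) ∧
      ∀ u u', IsLinSol p μ (Set.Ioo 0 T) ι A f 0 u u' →
        eNorm p μ (Set.Ioo 0 T) u u' ≤ C * wLpNorm p μ (Set.Ioo 0 T) f := by
  have hp0 : 0 < p := by linarith
  have hone : (1:ENNReal) ≤ ENNReal.ofReal p := by simpa using hp.le
  have hp1 : 1 / p < 1 := by rw [div_lt_one hp0]; exact hp
  have i0 := initSeg_Ioi
  have hE : ∀ f : ℝ → X₀, MemLp f (ENNReal.ofReal p) (volume.restrict (Ioi 0)) →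
      ∃ u : ℝ → X₁, MemLp u (ENNReal.ofReal p) (volume.restrict (Ioi 0)) ∧
        ISol (Ioi 0) ι A f u := by
    intro f hf
    obtain ⟨⟨u, u', h⟩, -⟩ := hMR f ((aux_memW_iff p 1 hp _ i0.mS i0.pos f).2 (by simpa using hf))
    have hu := (aux_memW_iff p 1 hp _ i0.mS i0.pos u).1 h.1.1
    exact ⟨u, by simpa using hu, aux_to_ISol p 1 hp hp1 i0 h⟩
  have hU : ∀ u : ℝ → X₁, MemLp u (ENNReal.ofReal p) (volume.restrict (Ioi 0)) →
      ISol (Ioi 0) ι A 0 u → ∀ᵐ t ∂(volume.restrict (Ioi 0)), u t = 0 := by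
    intro u hu hs
    have z0 : ISol (Ioi 0) ι A (0 : ℝ → X₀) (0 : ℝ → X₁) := .of_forall fun t => by simp
    have h1 := aux_of_ISol p 1 hp hp1 i0 (f := 0) (by simp) (by simpa using hu) hs
    have h2 := aux_of_ISol p 1 hp hp1 i0 (f := 0) (u := 0) (by simp) (by simp) z0
    exact (hMR 0 ((aux_memW_iff p 1 hp _ i0.mS i0.pos 0).2 (by simp))).2 _ _ _ _ h1 h2
  obtain ⟨C, hC, hfin⟩ := aux_fin p hp hE hU
  set α := 1 - μ with hαd
  have hα0 : 0 ≤ α := by linarith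
  have hα : α < 1 - 1 / p := by linarith
  obtain ⟨K, hK, hap⟩ := aux_apriori p α hp hα0 hα hC (fun T hT => (hfin T hT).2)
  have hK0 : 0 ≤ K.toReal := ENNReal.toReal_nonneg
  refine ⟨K.toReal + (1 + ‖A‖ * K.toReal), by positivity, fun T hT f hf => ?_⟩
  have iT := initSeg_Ioo T hT
  have hf' := (aux_memW_iff p μ hp _ iT.mS iT.pos f).1 hf
  rw [← hαd] at hf'
  refine ⟨?_, ?_, ?_⟩
  · obtain ⟨u, hu, hs⟩ := aux_exist p α hp hα0 hα hK hT (hfin T hT).1 (hap T hT) hf'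
    exact ⟨u, _, aux_of_ISol p μ hp hμ iT hf' hu hs⟩
  · intro u₁ u₁' u₂ u₂' h1 h2
    have m1 := (aux_memW_iff p μ hp _ iT.mS iT.pos u₁).1 h1.1.1
    have m2 := (aux_memW_iff p μ hp _ iT.mS iT.pos u₂).1 h2.1.1
    rw [← hαd] at m1 m2
    have s1 := aux_to_ISol p μ hp hμ iT h1
    have s2 := aux_to_ISol p μ hp hμ iT h2
    have hlin := ISol.lin iT (-1) s1 s2 (aux_intble p α hp hα iT hf') (aux_intble p α hp hα iT hf')
      (aux_intble p α hp hα iT m1) (aux_intble p α hp hα iT m2)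
    have hm : MemLp (fun t : ℝ => t ^ α • (u₁ t + (-1:ℂ) • u₂ t)) (ENNReal.ofReal p)
        (volume.restrict (Ioo 0 T)) := by
      have e1 : (fun t : ℝ => t ^ α • (u₁ t + (-1:ℂ) • u₂ t)) =
          (fun t => t ^ α • u₁ t) - fun t => t ^ α • u₂ t := by
        ext t; simp [smul_sub, sub_eq_add_neg]
      rw [e1]; exact m1.sub m2
    have h := hap T hT 0 _ (by simp) hm
      (hlin.congr iT (.of_forall fun t => by simp) (.of_forall fun t => rfl))
    have h0 : eLpNorm (fun t : ℝ => t ^ α • (0 : ℝ → X₀) t) (ENNReal.ofReal p)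
        (volume.restrict (Ioo 0 T)) = 0 := by simp
    rw [h0, mul_zero, nonpos_iff_eq_zero, eLpNorm_eq_zero_iff hm.1 (by simpa using hp0)] at h
    filter_upwards [h, ae_restrict_mem measurableSet_Ioo] with t h3 ht
    have hta : t ^ α ≠ 0 := (Real.rpow_pos_of_pos ht.1 α).ne'
    have h4 : u₁ t + (-1:ℂ) • u₂ t = 0 := (smul_eq_zero.1 h3).resolve_left hta
    have : u₁ t - u₂ t = 0 := by simpa [sub_eq_add_neg] using h4
    exact sub_eq_zero.1 this
  · intro u u' h
    have m1 := (aux_memW_iff p μ hp _ iT.mS iT.pos u).1 h.1.1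
    rw [← hαd] at m1
    have s1 := aux_to_ISol p μ hp hμ iT h
    have b1 := hap T hT f u hf' m1 s1
    have b2 : eLpNorm (fun t => t ^ α • u' t) (ENNReal.ofReal p) (volume.restrict (Ioo 0 T)) ≤
        (1 + ‖A‖ₑ * K) *
          eLpNorm (fun t => t ^ α • f t) (ENNReal.ofReal p) (volume.restrict (Ioo 0 T)) := by
      have e : (fun t => t ^ α • u' t) =ᵐ[volume.restrict (Ioo 0 T)]
          (fun t => t ^ α • f t) - fun t => t ^ α • A (u t) := by
        filter_upwards [h.2.1] with t ht
        rw [Pi.sub_apply, ← smul_sub, ← ht, add_sub_cancel_right]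
      rw [eLpNorm_congr_ae e]
      refine (eLpNorm_sub_le hf'.1 (aux_clm_memLp A m1).1 hone).trans ?_
      rw [add_mul, one_mul, mul_assoc]
      exact add_le_add le_rfl ((aux_clm_norm A u).trans (mul_le_mul' le_rfl b1))
    have n1 := aux_wLpNorm p μ hp _ iT.mS iT.pos u h.1.1
    have n2 := aux_wLpNorm p μ hp _ iT.mS iT.pos u' h.1.2.2.1
    have n3 := aux_wLpNorm p μ hp _ iT.mS iT.pos f hf
    have c1 : wLpNorm p μ (Ioo 0 T) u ≤ K.toReal * wLpNorm p μ (Ioo 0 T) f := by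
      rw [n1, n3, ← ENNReal.toReal_mul]
      exact ENNReal.toReal_mono (ENNReal.mul_ne_top hK hf'.2.ne) b1
    have c2 : wLpNorm p μ (Ioo 0 T) u' ≤ (1 + ‖A‖ * K.toReal) * wLpNorm p μ (Ioo 0 T) f := by
      have ht : (1 + ‖A‖ₑ * K) ≠ ⊤ := ENNReal.add_ne_top.2
        ⟨by simp, ENNReal.mul_ne_top enorm_ne_top hK⟩
      have e : 1 + ‖A‖ * K.toReal = (1 + ‖A‖ₑ * K).toReal := by
        rw [ENNReal.toReal_add (by simp) (ENNReal.mul_ne_top enorm_ne_top hK), ENNReal.toReal_mul]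
        simp
      rw [n2, n3, e, ← ENNReal.toReal_mul]
      exact ENNReal.toReal_mono (ENNReal.mul_ne_top ht hf'.2.ne) b2
    have p1 : 0 ≤ wLpNorm p μ (Ioo 0 T) u := by rw [n1]; exact ENNReal.toReal_nonneg
    have p2 : 0 ≤ wLpNorm p μ (Ioo 0 T) u' := by rw [n2]; exact ENNReal.toReal_nonneg
    unfold eNorm
    refine (Real.rpow_add_rpow_le_add p1 p2 hp.le).trans ?_
    rw [add_mul]
    exact add_le_add c1 c2
end
end
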